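/- Let G be a finite group and let X and X' be G-modules that are free as ℤ-modules. For a positive integer r, the pair (X, X') is an r-encoding pair if and only if there is an exact sequence of G-modules 0 → X → P_r → P_{r-1} → ⋯ → P_2 → P_1 → X' → 0 in which each P_i is a projective ℤ[G]-module. -/

import Mathlib

/-!
This file sets up Tate cohomology of a finite group `G` (with coefficients in objects of
`Rep ℤ G`), realized concretely in each degree `n ∈ ℤ` as
`Ĥ^n(G, M) = Ĥ⁰(G, Hom_ℤ(J n, M))`, where `J n` is the standard `n`-th syzygy of the
trivial module `ℤ` (the `n`-th tensor power of the augmentation ideal `I_G` for `n ≥ 0`,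
and of its `ℤ`-linear dual for `n < 0`), and `Ĥ⁰` denotes invariants modulo norms.
Cup products are induced by the canonical comparison maps `J (i+j) ⟶ J i ⊗ J j`.
-/

open CategoryTheory MonoidalCategory TensorProduct

set_option linter.unusedSectionVars false
set_option maxHeartbeats 1000000

attribute [instance 0] AddCommGroup.toIntModule

namespace Enc

variable {k : Type} [CommRing k] {G : Type} [Group G] [Fintype G]

/-! ### Degree-zero Tate cohomology: invariants modulo norms -/

section Aux
variable {V V₂ : Type} [AddCommGroup V] [Module k V] [AddCommGroup V₂] [Module k V₂]

/-- The norm map `v ↦ ∑_{g ∈ G} g • v` of a representation. -/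
noncomputable def rnorm (ρ : Representation k G V) : V →ₗ[k] V := ∑ g : G, ρ g

lemma rnorm_mem_invariants (ρ : Representation k G V) (v : V) :
    rnorm ρ v ∈ ρ.invariants := by
  intro g
  show (ρ g) ((∑ h : G, ρ h) v) = _
  simp only [LinearMap.sum_apply, map_sum]
  rw [Fintype.sum_equiv (Equiv.mulLeft g) _ (fun h => ρ h v) (fun h => by
    rw [← Module.End.mul_apply, ← map_mul]; rfl)]
  simp [rnorm]

/-- The norm map, viewed as landing in the invariants. -/
noncomputable def rnormRes (ρ : Representation k G V) : V →ₗ[k] ρ.invariants :=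
  (rnorm ρ).codRestrict ρ.invariants (rnorm_mem_invariants ρ)

/-- The image of the norm map, inside the invariants. -/
noncomputable def rnormIm (ρ : Representation k G V) : Submodule k ρ.invariants :=
  LinearMap.range (rnormRes ρ)

/-- Degree-zero Tate cohomology of a representation: invariants modulo norms. -/
noncomputable def tate0 (ρ : Representation k G V) : Type :=
  ρ.invariants ⧸ rnormIm ρ

noncomputable instance (ρ : Representation k G V) : AddCommGroup (tate0 ρ) :=
  inferInstanceAs (AddCommGroup (ρ.invariants ⧸ rnormIm ρ))

noncomputable instance (ρ : Representation k G V) : Module k (tate0 ρ) :=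
  inferInstanceAs (Module k (ρ.invariants ⧸ rnormIm ρ))

/-- The Tate class of an invariant vector. -/
noncomputable def tate0mk {ρ : Representation k G V} (v : V) (hv : v ∈ ρ.invariants) :
    tate0 ρ := Submodule.Quotient.mk (⟨v, hv⟩ : ρ.invariants)

lemma invariants_comp {ρ : Representation k G V} {σ : Representation k G V₂}
    (f : V →ₗ[k] V₂) (hf : ∀ (g : G) (v : V), f (ρ g v) = σ g (f v)) :
    ∀ x ∈ ρ.invariants, f x ∈ σ.invariants := by
  intro x hx g
  rw [← hf g x, hx g]

/-- Functoriality of degree-zero Tate cohomology along equivariant maps. -/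
noncomputable def tate0map {ρ : Representation k G V} {σ : Representation k G V₂}
    (f : V →ₗ[k] V₂) (hf : ∀ (g : G) (v : V), f (ρ g v) = σ g (f v)) :
    tate0 ρ →ₗ[k] tate0 σ :=
  Submodule.mapQ (rnormIm ρ) (rnormIm σ) (f.restrict (invariants_comp f hf))
    (by
      rintro ⟨x, hx⟩ ⟨y, hy⟩
      refine ⟨f y, ?_⟩
      apply Subtype.ext
      have hy' := congrArg Subtype.val hy
      show rnorm σ (f y) = _
      simp only [LinearMap.restrict_apply]
      have : rnorm σ (f y) = f (rnorm ρ y) := by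
        simp only [rnorm, LinearMap.sum_apply, map_sum]
        exact Finset.sum_congr rfl fun g _ => (hf g y).symm
      rw [this]
      exact congrArg f hy')

lemma rnorm_apply (ρ : Representation k G V) (v : V) : rnorm ρ v = ∑ g : G, ρ g v := by
  simp [rnorm, LinearMap.sum_apply]

variable {V₃ V₄ V₅ : Type} [AddCommGroup V₃] [Module k V₃] [AddCommGroup V₄] [Module k V₄]
  [AddCommGroup V₅] [Module k V₅]

lemma map_conj_comp (f : V →ₗ[k] V₃) (g : V₂ →ₗ[k] V₄) (m : V₅ →ₗ[k] V ⊗[k] V₂)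
    (a : V →ₗ[k] V) (b : V₂ →ₗ[k] V₂) (c : V₃ →ₗ[k] V₃) (d : V₄ →ₗ[k] V₄) (p : V₅ →ₗ[k] V₅)
    (h : m ∘ₗ p = TensorProduct.map a b ∘ₗ m) :
    TensorProduct.map c d ∘ₗ (TensorProduct.map f g ∘ₗ m) ∘ₗ p
      = TensorProduct.map (c ∘ₗ f ∘ₗ a) (d ∘ₗ g ∘ₗ b) ∘ₗ m := by
  rw [LinearMap.comp_assoc, h, TensorProduct.map_comp, TensorProduct.map_comp]
  rfl

lemma map_sum_left_comp {ι : Type} (s : Finset ι) (f : ι → V →ₗ[k] V₃) (g : V₂ →ₗ[k] V₄)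
    (m : V₅ →ₗ[k] V ⊗[k] V₂) :
    TensorProduct.map (∑ i ∈ s, f i) g ∘ₗ m = ∑ i ∈ s, TensorProduct.map (f i) g ∘ₗ m :=
  map_sum ((LinearMap.lcomp k _ m).comp ((TensorProduct.mapBilinear (.id k) V V₂ V₃ V₄).flip g)) _ _

lemma map_sum_right_comp {ι : Type} (s : Finset ι) (f : V →ₗ[k] V₃) (g : ι → V₂ →ₗ[k] V₄)
    (m : V₅ →ₗ[k] V ⊗[k] V₂) :
    TensorProduct.map f (∑ i ∈ s, g i) ∘ₗ m = ∑ i ∈ s, TensorProduct.map f (g i) ∘ₗ m :=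
  map_sum ((LinearMap.lcomp k _ m).comp (TensorProduct.mapBilinear (.id k) V V₂ V₃ V₄ f)) _ _

lemma map_sub_left_comp (f f' : V →ₗ[k] V₃) (g : V₂ →ₗ[k] V₄) (m : V₅ →ₗ[k] V ⊗[k] V₂) :
    TensorProduct.map (f - f') g ∘ₗ m = TensorProduct.map f g ∘ₗ m - TensorProduct.map f' g ∘ₗ m :=
  map_sub ((LinearMap.lcomp k _ m).comp ((TensorProduct.mapBilinear (.id k) V V₂ V₃ V₄).flip g)) _ _

lemma map_sub_right_comp (f : V →ₗ[k] V₃) (g g' : V₂ →ₗ[k] V₄) (m : V₅ →ₗ[k] V ⊗[k] V₂) :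
    TensorProduct.map f (g - g') ∘ₗ m = TensorProduct.map f g ∘ₗ m - TensorProduct.map f g' ∘ₗ m :=
  map_sub ((LinearMap.lcomp k _ m).comp (TensorProduct.mapBilinear (.id k) V V₂ V₃ V₄ f)) _ _

end Aux

/-- Degree-zero Tate cohomology `Ĥ⁰(G, W) = W^G / N_G W` of an object of `Rep k G`. -/
noncomputable def H0T (W : Rep k G) : Type := tate0 W.ρ

noncomputable instance (W : Rep k G) : AddCommGroup (H0T W) :=
  inferInstanceAs (AddCommGroup (tate0 W.ρ))

noncomputable instance (W : Rep k G) : Module k (H0T W) :=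
  inferInstanceAs (Module k (tate0 W.ρ))

/-- Functoriality of `Ĥ⁰` along morphisms of representations. -/
noncomputable def H0Tmap {W W' : Rep k G} (ψ : W ⟶ W') : H0T W →ₗ[k] H0T W' :=
  tate0map ψ.hom (fun g v => Rep.hom_comm_apply ψ g v)

/-! ### The augmentation ideal and the syzygy modules `J n` -/

variable (G)

/-- The augmentation map `ℤ[G] → ℤ`. -/
noncomputable def aug : (G →₀ ℤ) →ₗ[ℤ] ℤ :=
  Finsupp.linearCombination ℤ (fun _ : G => (1 : ℤ))

lemma aug_comm (g : G) (x : G →₀ ℤ) :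
    aug G (Finsupp.lmapDomain ℤ ℤ (g • · : G → G) x) = aug G x := by
  unfold aug
  simp [Finsupp.linearCombination_apply]
  rw [Finsupp.sum_mapDomain_index] <;> simp

/-- The underlying `ℤ`-module of the augmentation ideal. -/
noncomputable abbrev IGcar : Type := LinearMap.ker (aug G)

/-- The representation of `G` on the augmentation ideal. -/
noncomputable def IGρ : Representation ℤ G (IGcar G) where
  toFun g := (Finsupp.lmapDomain ℤ ℤ (g • · : G → G)).restrict (p := LinearMap.ker (aug G))
    (q := LinearMap.ker (aug G)) (by
      intro x hx
      simp only [LinearMap.mem_ker] at hx ⊢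
      rw [aug_comm]; exact hx)
  map_one' := by
    ext x
    simp [LinearMap.restrict_apply]
    rw [show (fun x : G => x) = id from rfl, Finsupp.mapDomain_id]
  map_mul' g h := by
    ext x
    simp [LinearMap.restrict_apply, Module.End.mul_apply]
    rw [← Finsupp.mapDomain_comp]
    simp [Function.comp_def, mul_assoc]

/-- The augmentation ideal `I_G` of `ℤ[G]`, as an object of `Rep ℤ G`. -/
noncomputable def IGrep : Rep ℤ G := Rep.of (IGρ G)

/-- `Hom_ℤ(X, A)` with the conjugation `G`-action, i.e. the internal hom in `Rep ℤ G`. -/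
noncomputable abbrev hRep {G : Type} [Group G] (X A : Rep.{0} ℤ G) : Rep.{0} ℤ G :=
  (Rep.ihom X).obj A

/-- The `ℤ`-linear dual of the augmentation ideal, as an object of `Rep ℤ G`. -/
noncomputable def DIG : Rep ℤ G := hRep (IGrep G) (𝟙_ (Rep ℤ G))

instance : Module.Finite ℤ (IGcar G) := by
  have : Module.Finite ℤ (G →₀ ℤ) :=
    Module.Finite.equiv (Finsupp.linearEquivFunOnFinite ℤ ℤ G).symm
  exact Module.Finite.of_injective (LinearMap.ker (aug G)).subtype Subtype.val_injective

instance : Module.Free ℤ (IGcar G) := by infer_instance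

/-- Nonnegative tensor powers `I_G^{⊗ n}` (with `I_G^{⊗ 0} = ℤ`). -/
noncomputable def Jp : ℕ → Rep ℤ G
  | 0 => 𝟙_ (Rep ℤ G)
  | n + 1 => Jp n ⊗ IGrep G

/-- Tensor powers of the dual of the augmentation ideal. -/
noncomputable def Jn : ℕ → Rep ℤ G
  | 0 => 𝟙_ (Rep ℤ G)
  | n + 1 => Jn n ⊗ DIG G

/-- The standard syzygy modules of the trivial representation `ℤ`, indexed by `ℤ`:
`J n = I_G^{⊗ n}` for `n ≥ 0`, and `J n = (I_G^∨)^{⊗ (-n)}` for `n < 0`. -/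
noncomputable def J : ℤ → Rep ℤ G
  | .ofNat n => Jp G n
  | .negSucc n => Jn G (n + 1)

lemma J_ofNat (m : ℕ) : J G (m : ℤ) = Jp G m := rfl

lemma J_neg (m : ℕ) : J G (-(m : ℤ)) = Jn G m := by cases m <;> rfl

/-- The element of `(I_G)^∨ ⊗ I_G` corresponding to the identity map. -/
noncomputable def preElt : Module.Dual ℤ (IGcar G) ⊗[ℤ] IGcar G :=
  (dualTensorHomEquiv ℤ (IGcar G) (IGcar G)).symm LinearMap.id

/-- The canonical element of `I_G ⊗ (I_G)^∨` corresponding to the identity map. -/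
noncomputable def coevElt : (IGrep G ⊗ DIG G).V :=
  (TensorProduct.comm ℤ _ _) (preElt G)

lemma conj_dualTensor (g : G) (t : Module.Dual ℤ (IGcar G) ⊗[ℤ] IGcar G) :
    dualTensorHom ℤ _ _ (TensorProduct.map ((DIG G).ρ g) ((IGrep G).ρ g) t)
      = (IGrep G).ρ g ∘ₗ (dualTensorHom ℤ _ _ t) ∘ₗ (IGrep G).ρ g⁻¹ := by
  have key : ∀ t : Module.Dual ℤ (IGcar G) ⊗[ℤ] IGcar G,
      dualTensorHom ℤ (IGcar G) (IGcar G)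
          (TensorProduct.map (Module.Dual.transpose (R := ℤ) (IGρ G g⁻¹)) (IGρ G g) t)
        = IGρ G g ∘ₗ (dualTensorHom ℤ (IGcar G) (IGcar G) t) ∘ₗ IGρ G g⁻¹ := by
    intro t
    induction t with
    | zero => simp
    | tmul f v =>
        apply LinearMap.ext
        intro w
        simp only [TensorProduct.map_tmul, dualTensorHom_apply,
          LinearMap.comp_apply, map_smul]
        rfl
    | add x y hx hy =>
        simp only [map_add, hx, hy, LinearMap.add_comp, LinearMap.comp_add]
  exact key t

lemma coevElt_invariant (g : G) :
    ((IGrep G ⊗ DIG G).ρ g) (coevElt G) = coevElt G := by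
  show TensorProduct.map ((IGrep G).ρ g) ((DIG G).ρ g)
      ((TensorProduct.comm ℤ _ _) (preElt G)) = _
  refine (TensorProduct.map_comm _ _ _).trans ?_
  show (TensorProduct.comm ℤ _ _) (TensorProduct.map ((DIG G).ρ g) ((IGrep G).ρ g) (preElt G))
      = (TensorProduct.comm ℤ _ _) (preElt G)
  congr 1
  apply (dualTensorHomEquiv ℤ (IGcar G) (IGcar G)).injective
  have h2 : dualTensorHom ℤ (IGcar G) (IGcar G) (preElt G) = LinearMap.id :=
    (dualTensorHomEquiv ℤ (IGcar G) (IGcar G)).apply_symm_apply LinearMap.id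
  show dualTensorHom ℤ (IGcar G) (IGcar G)
      (TensorProduct.map ((DIG G).ρ g) ((IGrep G).ρ g) (preElt G))
    = dualTensorHom ℤ (IGcar G) (IGcar G) (preElt G)
  refine (conj_dualTensor G g (preElt G)).trans ?_
  show (IGrep G).ρ g ∘ₗ dualTensorHom ℤ (IGcar G) (IGcar G) (preElt G) ∘ₗ (IGrep G).ρ g⁻¹
      = dualTensorHom ℤ (IGcar G) (IGcar G) (preElt G)
  rw [h2]
  apply LinearMap.ext
  intro v
  exact Representation.self_inv_apply (IGρ G) g v

/-- The coevaluation `ℤ ⟶ I_G ⊗ I_G^∨`. -/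
noncomputable def coev : 𝟙_ (Rep ℤ G) ⟶ IGrep G ⊗ DIG G := Rep.ofHom {
  toLinearMap := LinearMap.toSpanSingleton ℤ _ (coevElt G)
  isIntertwining' := by
    intro g
    apply LinearMap.ext
    intro z
    show LinearMap.toSpanSingleton ℤ _ (coevElt G) ((𝟙_ (Rep ℤ G)).ρ g z)
        = ((IGrep G ⊗ DIG G).ρ g) (LinearMap.toSpanSingleton ℤ _ (coevElt G) z)
    have hz : ((𝟙_ (Rep ℤ G)).ρ g z) = z := rfl
    rw [hz]
    show z • coevElt G = ((IGrep G ⊗ DIG G).ρ g) (z • coevElt G)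
    rw [map_smul, coevElt_invariant] }


variable {G}

/-- One-step comparison `J (n+1) ⟶ J n ⊗ I_G`. -/
noncomputable def sMap : ∀ n : ℤ, J G (n + 1) ⟶ J G n ⊗ IGrep G
  | .ofNat m => 𝟙 (Jp G m ⊗ IGrep G)
  | .negSucc 0 =>
      coev G ≫ (β_ (IGrep G) (DIG G)).hom ≫ ((λ_ (DIG G)).inv ▷ IGrep G)
  | .negSucc (m+1) =>
      (ρ_ (Jn G (m+1))).inv ≫ (Jn G (m+1) ◁ (coev G ≫ (β_ (IGrep G) (DIG G)).hom))
        ≫ (α_ (Jn G (m+1)) (DIG G) (IGrep G)).inv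

/-- One-step comparison `J (n-1) ⟶ J n ⊗ I_G^∨`. -/
noncomputable def tMap : ∀ n : ℤ, J G (n - 1) ⟶ J G n ⊗ DIG G
  | .ofNat 0 => 𝟙 (𝟙_ (Rep ℤ G) ⊗ DIG G)
  | .ofNat (m+1) =>
      eqToHom (congrArg (J G) (show (Int.ofNat (m+1)) - 1 = ((m:ℕ) : ℤ) by
        rw [Int.ofNat_eq_coe]; push_cast; ring)) ≫
      (ρ_ (Jp G m)).inv ≫ (Jp G m ◁ coev G) ≫ (α_ (Jp G m) (IGrep G) (DIG G)).inv
  | .negSucc m => eqToHom (show J G (Int.negSucc m - 1) = J G (Int.negSucc m) ⊗ DIG G from rfl)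

/-- Comparison maps `J (i + m) ⟶ J i ⊗ J m` for `m ≥ 0`. -/
noncomputable def μpos (i : ℤ) : ∀ m : ℕ, J G (i + m) ⟶ J G i ⊗ J G (m : ℤ)
  | 0 => eqToHom (congrArg (J G) (by omega)) ≫ (ρ_ (J G i)).inv
  | m + 1 =>
      eqToHom (congrArg (J G) (show i + ((m:ℕ)+1:ℕ) = (i + m) + 1 by omega))
        ≫ sMap (i + m) ≫ (μpos i m ▷ IGrep G) ≫ (α_ (J G i) (J G (m:ℤ)) (IGrep G)).hom

/-- Comparison maps `J (i - m) ⟶ J i ⊗ J (-m)` for `m ≥ 0`. -/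
noncomputable def μneg (i : ℤ) : ∀ m : ℕ, J G (i - m) ⟶ J G i ⊗ J G (-(m : ℤ))
  | 0 => eqToHom (congrArg (J G) (by omega)) ≫ (ρ_ (J G i)).inv
  | m + 1 =>
      eqToHom (congrArg (J G) (show i - ((m:ℕ)+1:ℕ) = (i - m) - 1 by omega))
        ≫ tMap (i - m) ≫ (μneg i m ▷ DIG G) ≫ (α_ (J G i) (J G (-(m:ℤ))) (DIG G)).hom
        ≫ (J G i ◁ (eqToHom (show J G (-(m:ℤ)) ⊗ DIG G = J G (-((m:ℕ)+1:ℕ)) by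
            rw [J_neg, J_neg]; rfl)))

variable (G)

/-- The canonical comparison map `J (i+j) ⟶ J i ⊗ J j`, implementing the standard stable
equivalences between the syzygies `J`; it induces the cup product on Tate cohomology. -/
noncomputable def μ (i : ℤ) : ∀ j : ℤ, J G (i + j) ⟶ J G i ⊗ J G j
  | .ofNat m => μpos i m
  | .negSucc m =>
      eqToHom (congrArg (J G) (show i + Int.negSucc m = i - ((m+1 : ℕ) : ℤ) by
        rw [Int.negSucc_eq]; push_cast; ring))
        ≫ μneg i (m+1)

variable {G}

/-! ### Tate cohomology in all degrees, functoriality, cup products -/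

/-- Tate cohomology `Ĥ^n(G, M)` of the finite group `G` with coefficients in `M : Rep ℤ G`,
realized as `Ĥ⁰(G, Hom_ℤ(J n, M))` for the standard `n`-th syzygy `J n` of `ℤ`. -/
noncomputable def tate (n : ℤ) (M : Rep ℤ G) : Type := H0T (hRep (J G n) M)

noncomputable instance (n : ℤ) (M : Rep ℤ G) : AddCommGroup (tate n M) :=
  inferInstanceAs (AddCommGroup (H0T (hRep (J G n) M)))

/-- The map on Tate cohomology induced by a morphism of representations. -/
noncomputable def tmap (n : ℤ) {M N : Rep ℤ G} (φ : M ⟶ N) : tate n M → tate n N :=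
  H0Tmap ((Rep.ihom (J G n)).map φ)

/-- Transport of Tate cohomology along an equality of degrees. -/
noncomputable def tcast {i j : ℤ} {M : Rep ℤ G} (h : i = j) (z : tate i M) : tate j M :=
  h ▸ z

lemma hom_invariant {X W : Rep.{0} ℤ G} (m : X ⟶ W) :
    m.hom.toLinearMap ∈ (hRep X W).ρ.invariants := by
  intro g
  show W.ρ g ∘ₗ m.hom.toLinearMap ∘ₗ X.ρ g⁻¹ = m.hom.toLinearMap
  apply LinearMap.ext
  intro v
  exact (congrArg (W.ρ g) (Rep.hom_comm_apply m g⁻¹ v)).trans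
    (Representation.self_inv_apply W.ρ g _)

/-- The Tate cohomology class of a `G`-equivariant map `J n ⟶ W`. -/
noncomputable def mkCls {n : ℤ} {W : Rep ℤ G} (m : J G n ⟶ W) : tate n W :=
  tate0mk (ρ := (hRep (J G n) W).ρ) m.hom.toLinearMap (hom_invariant m)


lemma tensor_rho_eq (M N : Rep ℤ G) (g : G) :
    (M ⊗ N).ρ g = TensorProduct.map (M.ρ g) (N.ρ g) := rfl

lemma cup_invariance {i j : ℤ} {M N : Rep ℤ G}
    (f : ((hRep (J G i) M).ρ.invariants))
    (g : ((hRep (J G j) N).ρ.invariants)) :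
    (TensorProduct.map f.1 g.1).comp ((μ G i j).hom.toLinearMap)
      ∈ (hRep (J G (i + j)) (M ⊗ N)).ρ.invariants := by
  intro gg
  have hf : M.ρ gg ∘ₗ f.1 ∘ₗ (J G i).ρ gg⁻¹ = f.1 := f.2 gg
  have hg : N.ρ gg ∘ₗ g.1 ∘ₗ (J G j).ρ gg⁻¹ = g.1 := g.2 gg
  have hμ : (μ G i j).hom.toLinearMap.comp ((J G (i + j)).ρ gg⁻¹)
      = (TensorProduct.map ((J G i).ρ gg⁻¹) ((J G j).ρ gg⁻¹)).comp (μ G i j).hom.toLinearMap := by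
    have h := (μ G i j).hom.isIntertwining' gg⁻¹
    exact h
  refine (map_conj_comp f.1 g.1 (μ G i j).hom.toLinearMap _ _ (M.ρ gg) (N.ρ gg) _ hμ).trans ?_
  exact congrArg₂ (fun (a : (J G i).V →ₗ[ℤ] M.V) (b : (J G j).V →ₗ[ℤ] N.V) =>
    TensorProduct.map a b ∘ₗ (μ G i j).hom.toLinearMap) hf hg

lemma conj_term {i j : ℤ} {M N : Rep ℤ G} (u : (J G i).V →ₗ[ℤ] M.V)
    (w : (J G j).V →ₗ[ℤ] N.V) (h : G) :
    (TensorProduct.map (M.ρ h ∘ₗ u ∘ₗ (J G i).ρ h⁻¹) (N.ρ h ∘ₗ w ∘ₗ (J G j).ρ h⁻¹)).comp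
        (μ G i j).hom.toLinearMap
      = ((hRep (J G (i + j)) (M ⊗ N)).ρ h) ((TensorProduct.map u w).comp (μ G i j).hom.toLinearMap) := by
  have hμ : (μ G i j).hom.toLinearMap ∘ₗ (J G (i + j)).ρ h⁻¹
      = TensorProduct.map ((J G i).ρ h⁻¹) ((J G j).ρ h⁻¹) ∘ₗ (μ G i j).hom.toLinearMap := by
    have hc := (μ G i j).hom.isIntertwining' h⁻¹
    exact hc
  exact (map_conj_comp u w (μ G i j).hom.toLinearMap _ _ (M.ρ h) (N.ρ h) _ hμ).symm

lemma cup_norm_left {i j : ℤ} {M N : Rep ℤ G} (u : (J G i).V →ₗ[ℤ] M.V)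
    (g : ((hRep (J G j) N).ρ.invariants)) :
    (TensorProduct.map (rnorm ((hRep (J G i) M).ρ) u) g.1).comp (μ G i j).hom.toLinearMap
      = rnorm ((hRep (J G (i + j)) (M ⊗ N)).ρ)
          ((TensorProduct.map u g.1).comp (μ G i j).hom.toLinearMap) := by
  have h1 : rnorm ((hRep (J G i) M).ρ) u = ∑ h : G, ((hRep (J G i) M).ρ h) u :=
    rnorm_apply ((hRep (J G i) M).ρ) _
  refine (congrArg (fun a : (J G i).V →ₗ[ℤ] M.V =>
    TensorProduct.map a g.1 ∘ₗ (μ G i j).hom.toLinearMap) h1).trans ?_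
  refine (map_sum_left_comp _ _ _ _).trans ?_
  refine Eq.trans ?_ (rnorm_apply ((hRep (J G (i + j)) (M ⊗ N)).ρ) _).symm
  refine Finset.sum_congr rfl fun h _ => ?_
  have hginv : N.ρ h ∘ₗ g.1 ∘ₗ (J G j).ρ h⁻¹ = g.1 := g.2 h
  refine Eq.trans ?_ (conj_term u g.1 h)
  exact congrArg (fun b : (J G j).V →ₗ[ℤ] N.V => TensorProduct.map
    (M.ρ h ∘ₗ u ∘ₗ (J G i).ρ h⁻¹) b ∘ₗ (μ G i j).hom.toLinearMap) hginv.symm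

lemma cup_norm_right {i j : ℤ} {M N : Rep ℤ G}
    (f : ((hRep (J G i) M).ρ.invariants)) (w : (J G j).V →ₗ[ℤ] N.V) :
    (TensorProduct.map f.1 (rnorm ((hRep (J G j) N).ρ) w)).comp (μ G i j).hom.toLinearMap
      = rnorm ((hRep (J G (i + j)) (M ⊗ N)).ρ)
          ((TensorProduct.map f.1 w).comp (μ G i j).hom.toLinearMap) := by
  have h1 : rnorm ((hRep (J G j) N).ρ) w = ∑ h : G, ((hRep (J G j) N).ρ h) w :=
    rnorm_apply ((hRep (J G j) N).ρ) _
  refine (congrArg (fun b : (J G j).V →ₗ[ℤ] N.V =>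
    TensorProduct.map f.1 b ∘ₗ (μ G i j).hom.toLinearMap) h1).trans ?_
  refine (map_sum_right_comp _ _ _ _).trans ?_
  refine Eq.trans ?_ (rnorm_apply ((hRep (J G (i + j)) (M ⊗ N)).ρ) _).symm
  refine Finset.sum_congr rfl fun h _ => ?_
  have hfinv : M.ρ h ∘ₗ f.1 ∘ₗ (J G i).ρ h⁻¹ = f.1 := f.2 h
  refine Eq.trans ?_ (conj_term f.1 w h)
  exact congrArg (fun a : (J G i).V →ₗ[ℤ] M.V => TensorProduct.map
    a (N.ρ h ∘ₗ w ∘ₗ (J G j).ρ h⁻¹) ∘ₗ (μ G i j).hom.toLinearMap) hfinv.symm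

lemma cup_welldef {i j : ℤ} {M N : Rep ℤ G}
    (a₁ : ((hRep (J G i) M).ρ.invariants)) (b₁ : ((hRep (J G j) N).ρ.invariants))
    (a₂ : ((hRep (J G i) M).ρ.invariants)) (b₂ : ((hRep (J G j) N).ρ.invariants))
    (ha : a₁ - a₂ ∈ rnormIm ((hRep (J G i) M).ρ))
    (hb : b₁ - b₂ ∈ rnormIm ((hRep (J G j) N).ρ)) :
    tate0mk (ρ := (hRep (J G (i + j)) (M ⊗ N)).ρ) ((TensorProduct.map a₁.1 b₁.1).comp ((μ G i j).hom.toLinearMap)) (cup_invariance a₁ b₁)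
      = tate0mk (ρ := (hRep (J G (i + j)) (M ⊗ N)).ρ) ((TensorProduct.map a₂.1 b₂.1).comp ((μ G i j).hom.toLinearMap)) (cup_invariance a₂ b₂) := by
  obtain ⟨u, hu⟩ := ha
  obtain ⟨w, hw⟩ := hb
  have hu' : rnorm ((hRep (J G i) M).ρ) u = a₁.1 - a₂.1 := congrArg Subtype.val hu
  have hw' : rnorm ((hRep (J G j) N).ρ) w = b₁.1 - b₂.1 := congrArg Subtype.val hw
  have step1 : tate0mk (ρ := (hRep (J G (i + j)) (M ⊗ N)).ρ) ((TensorProduct.map a₁.1 b₁.1).comp ((μ G i j).hom.toLinearMap))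
        (cup_invariance a₁ b₁)
      = tate0mk (ρ := (hRep (J G (i + j)) (M ⊗ N)).ρ) ((TensorProduct.map a₂.1 b₁.1).comp ((μ G i j).hom.toLinearMap)) (cup_invariance a₂ b₁) := by
    refine (Submodule.Quotient.eq _).mpr ?_
    refine ⟨(TensorProduct.map u b₁.1).comp ((μ G i j).hom.toLinearMap), ?_⟩
    apply Subtype.ext
    have key := cup_norm_left u b₁
    refine key.symm.trans ?_
    refine (congrArg (fun a : (J G i).V →ₗ[ℤ] M.V =>
      TensorProduct.map a b₁.1 ∘ₗ (μ G i j).hom.toLinearMap) hu').trans ?_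
    exact map_sub_left_comp _ _ _ _
  have step2 : tate0mk (ρ := (hRep (J G (i + j)) (M ⊗ N)).ρ) ((TensorProduct.map a₂.1 b₁.1).comp ((μ G i j).hom.toLinearMap))
        (cup_invariance a₂ b₁)
      = tate0mk (ρ := (hRep (J G (i + j)) (M ⊗ N)).ρ) ((TensorProduct.map a₂.1 b₂.1).comp ((μ G i j).hom.toLinearMap)) (cup_invariance a₂ b₂) := by
    refine (Submodule.Quotient.eq _).mpr ?_
    refine ⟨(TensorProduct.map a₂.1 w).comp ((μ G i j).hom.toLinearMap), ?_⟩
    apply Subtype.ext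
    have key := cup_norm_right a₂ w
    refine key.symm.trans ?_
    refine (congrArg (fun b : (J G j).V →ₗ[ℤ] N.V =>
      TensorProduct.map a₂.1 b ∘ₗ (μ G i j).hom.toLinearMap) hw').trans ?_
    exact map_sub_right_comp _ _ _ _
  exact step1.trans step2

/-- The cup product `Ĥ^i(G, M) × Ĥ^j(G, N) → Ĥ^{i+j}(G, M ⊗ N)` on Tate cohomology,
induced by the comparison maps `μ`. -/
noncomputable def cup {i j : ℤ} {M N : Rep ℤ G} (z₁ : tate i M) (z₂ : tate j N) :
    tate (i + j) (M ⊗ N) :=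
  Quotient.liftOn₂ z₁ z₂
    (fun f g => tate0mk (ρ := (hRep (J G (i + j)) (M ⊗ N)).ρ) ((TensorProduct.map f.1 g.1).comp ((μ G i j).hom.toLinearMap)) (cup_invariance f g))
    (fun a₁ b₁ a₂ b₂ ha hb => cup_welldef a₁ b₁ a₂ b₂
      ((Submodule.quotientRel_def _).mp ha) ((Submodule.quotientRel_def _).mp hb))

/-! ### Pairings -/

/-- The composition pairing `Hom_ℤ(B, C) ⊗ Hom_ℤ(A, B) ⟶ Hom_ℤ(A, C)`, `f ⊗ φ ↦ f ∘ φ`. -/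
noncomputable def compPair (A B C : Rep ℤ G) : hRep B C ⊗ hRep A B ⟶ hRep A C :=
  MonoidalClosed.curry <|
    (A ◁ (β_ (hRep B C) (hRep A B)).hom) ≫ (α_ A (hRep A B) (hRep B C)).inv
      ≫ (((ihom.ev A).app B) ▷ hRep B C) ≫ (ihom.ev B).app C

/-- The evaluation pairing `Hom_ℤ(X, B) ⊗ X ⟶ B`, `f ⊗ x ↦ f x`. -/
noncomputable def evPair (X B : Rep ℤ G) : hRep X B ⊗ X ⟶ B :=
  (β_ (hRep X B) X).hom ≫ (ihom.ev X).app B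

/-- The cup product `Ĥ^i(G, Hom(X, A)) × Ĥ^j(G, Hom(X', X)) → Ĥ^{i+j}(G, Hom(X', A))`
induced by the composition pairing. -/
noncomputable def ccup {i j : ℤ} {X X' A : Rep ℤ G}
    (z : tate i (hRep X A)) (x : tate j (hRep X' X)) : tate (i + j) (hRep X' A) :=
  tmap (i + j) (compPair X' X A) (cup z x)

/-- `ccup`, with the degree of the target adjusted along an equality of integers. -/
noncomputable def ccupTo {i j m : ℤ} {X X' A : Rep ℤ G}
    (z : tate i (hRep X A)) (x : tate j (hRep X' X)) (h : i + j = m) :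
    tate m (hRep X' A) :=
  tcast h (ccup z x)

/-- The class of the identity in `Ĥ⁰(G, Hom_ℤ(X, X))`. -/
noncomputable def idCls (X : Rep ℤ G) : tate 0 (hRep X X) :=
  mkCls (MonoidalClosed.curry (ρ_ X).hom)

/-! ### Encoding pairs and related notions -/

/-- `(X, X')` is an *`r`-encoding pair* if for some `i ∈ ℤ` there is a natural isomorphism
of functors `Ĥ^i(G, Hom_ℤ(X, -)) ≅ Ĥ^{i+r}(G, Hom_ℤ(X', -))` on `Rep ℤ G`. -/
def IsEncodingPair {G : Type} [Group G] [Fintype G] (r : ℤ) (X X' : Rep ℤ G) : Prop :=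
  ∃ (i : ℤ) (e : ∀ A : Rep ℤ G, tate i (hRep X A) ≃+ tate (i + r) (hRep X' A)),
    ∀ {A B : Rep ℤ G} (φ : A ⟶ B) (z : tate i (hRep X A)),
      e B (tmap i ((Rep.ihom X).map φ) z) = tmap (i + r) ((Rep.ihom X').map φ) (e A z)

/-- `x ∈ Ĥ^r(G, Hom_ℤ(X', X))` is an *encoding element* for the pair `(X, X')` if it has a
*decoding element* `x' ∈ Ĥ^{-r}(G, Hom_ℤ(X, X'))` with `x' ∪ x = [id_{X'}]` and
`x ∪ x' = [id_X]`. -/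
def IsEncodingElement {G : Type} [Group G] [Fintype G] {r : ℤ} (X X' : Rep ℤ G)
    (x : tate r (hRep X' X)) : Prop :=
  ∃ x' : tate (-r) (hRep X X'),
    ccupTo x' x (by ring) = idCls X' ∧ ccupTo x x' (by ring) = idCls X

/-- The induced `G`-module `ℤ[G] ⊗_ℤ A ≅ (G →₀ A)`, with `G` acting by left translation. -/
noncomputable def indRep (G : Type) [Group G] (A : Type) [AddCommGroup A] [Module ℤ A] :
    Rep ℤ G :=
  Rep.of (G := G) (X := G →₀ A)
    { toFun := fun g => Finsupp.lmapDomain A ℤ (fun h => g * h)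
      map_one' := by
        ext x h
        simp [Finsupp.lmapDomain_apply, Finsupp.mapDomain_id, one_mul]
      map_mul' := fun g g' => by
        ext x h
        simp [Finsupp.lmapDomain_apply, Module.End.mul_apply, Finsupp.mapDomain_single,
          mul_assoc] }

/-- A `G`-module is *induced* if it is isomorphic to `ℤ[G] ⊗_ℤ A` for some abelian group `A`. -/
def IsInduced {G : Type} [Group G] (M : Rep ℤ G) : Prop :=
  ∃ (A : Type) (_ : AddCommGroup A) (_ : Module ℤ A), Nonempty (M ≅ indRep G A)

/-- A class `φ ∈ Ĥ⁰(G, Hom_ℤ(X, X))` is a unit for the (composition) cup product. -/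
def IsUnitCls {G : Type} [Group G] [Fintype G] {X : Rep ℤ G}
    (φ : tate 0 (hRep X X)) : Prop :=
  ∃ ψ : tate 0 (hRep X X),
    ccupTo φ ψ (by ring) = idCls X ∧ ccupTo ψ φ (by ring) = idCls X


/-- The natural map `Hom_ℤ(X, A) ⊗ I_G ⟶ Hom_ℤ(X, A ⊗ I_G)`, `f ⊗ z ↦ (x ↦ f x ⊗ z)`. -/
noncomputable def pr0 (X A : Rep ℤ G) : hRep X A ⊗ IGrep G ⟶ hRep X (A ⊗ IGrep G) :=
  MonoidalClosed.curry ((α_ X (hRep X A) (IGrep G)).inv ≫ ((ihom.ev X).app A ▷ IGrep G))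

/-- The natural evaluation map `Hom_ℤ(X, Hom_ℤ(I_G, A)) ⊗ I_G ⟶ Hom_ℤ(X, A)`,
`f ⊗ z ↦ (x ↦ f x z)`. -/
noncomputable def pr1 (X A : Rep ℤ G) :
    hRep X (hRep (IGrep G) A) ⊗ IGrep G ⟶ hRep X A :=
  MonoidalClosed.curry ((α_ X (hRep X (hRep (IGrep G) A)) (IGrep G)).inv
    ≫ ((ihom.ev X).app (hRep (IGrep G) A) ▷ IGrep G) ≫ evPair (IGrep G) A)

/-- The natural evaluation map `Hom_ℤ(X', X) ⊗ (X' ⊗ A) ⟶ X ⊗ A`. -/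
noncomputable def tPair (X' X A : Rep ℤ G) : hRep X' X ⊗ (X' ⊗ A) ⟶ X ⊗ A :=
  (α_ (hRep X' X) X' A).inv ≫ (evPair X' X ▷ A)

/-- A functor `Rep ℤ G ⥤ Rep ℤ G` sends `ℤ`-split short exact sequences of `G`-modules to
short exact sequences of `G`-modules. -/
def PreservesZSplitSES {G : Type} [Group G] (F : Rep.{0} ℤ G ⥤ Rep.{0} ℤ G) : Prop :=
  ∀ (A B C : Rep.{0} ℤ G) (f : A ⟶ B) (g : B ⟶ C),
    Function.Injective f.hom → Function.Surjective g.hom → Function.Exact f.hom g.hom →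
    (∃ s : C.V →+ B.V, ∀ x, g.hom (s x) = x) →
    Function.Injective (F.map f).hom ∧ Function.Surjective (F.map g).hom ∧
      Function.Exact (F.map f).hom (F.map g).hom

/-- A *shiftable functor*: it sends `ℤ`-split short exact sequences of `G`-modules to short
exact sequences, and sends induced modules to induced modules. -/
def Shiftable {G : Type} [Group G] (F : Rep.{0} ℤ G ⥤ Rep.{0} ℤ G) : Prop :=
  PreservesZSplitSES F ∧ ∀ M : Rep ℤ G, IsInduced M → IsInduced (F.obj M)

end Enc

open CategoryTheory MonoidalCategory Enc

open TensorProduct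

/-! ### Stable equivalence of representations -/

section Stable

open TensorProduct

variable {k : Type} [CommRing k] {G : Type} [Group G] [Fintype G]
variable {V V₂ V₃ V₄ V₅ : Type} [AddCommGroup V] [Module k V] [AddCommGroup V₂] [Module k V₂]
  [AddCommGroup V₃] [Module k V₃] [AddCommGroup V₄] [Module k V₄]
  [AddCommGroup V₅] [Module k V₅]
  {ρ : Representation k G V} {σ : Representation k G V₂} {τ : Representation k G V₃}
  {υ : Representation k G V₄} {ω : Representation k G V₅}

/-- Equivariance of a linear map. -/
def Eqv (ρ : Representation k G V) (σ : Representation k G V₂) (f : V →ₗ[k] V₂) : Prop :=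
  ∀ g x, f (ρ g x) = σ g (f x)

/-- The norm of a linear map. -/
noncomputable def nrm (ρ : Representation k G V) (σ : Representation k G V₂) (u : V →ₗ[k] V₂) :
    V →ₗ[k] V₂ := ∑ g : G, σ g ∘ₗ u ∘ₗ ρ g⁻¹

lemma nrm_apply (u : V →ₗ[k] V₂) (x : V) :
    nrm ρ σ u x = ∑ g : G, σ g (u (ρ g⁻¹ x)) := by
  simp [nrm]

lemma Eqv.comp {f : V →ₗ[k] V₂} {h : V₂ →ₗ[k] V₃} (hh : Eqv σ τ h) (hf : Eqv ρ σ f) :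
    Eqv ρ τ (h ∘ₗ f) := by
  intro g x
  simp [hf g x, hh g]

lemma Eqv.id : Eqv ρ ρ LinearMap.id := fun _ _ => rfl

lemma Eqv.sub {f h : V →ₗ[k] V₂} (hf : Eqv ρ σ f) (hh : Eqv ρ σ h) : Eqv ρ σ (f - h) := by
  intro g x
  simp [hf g x, hh g x]

lemma comp_nrm {f : V₂ →ₗ[k] V₃} (hf : Eqv σ τ f) (u : V →ₗ[k] V₂) :
    f ∘ₗ nrm ρ σ u = nrm ρ τ (f ∘ₗ u) := by
  ext x
  simp [nrm_apply, hf _ _]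

lemma nrm_comp {f : V →ₗ[k] V₂} (hf : Eqv ρ σ f) (u : V₂ →ₗ[k] V₃) :
    nrm σ τ u ∘ₗ f = nrm ρ τ (u ∘ₗ f) := by
  ext x
  simp [nrm_apply, hf _ _]

lemma nrm_add (u v : V →ₗ[k] V₂) : nrm ρ σ (u + v) = nrm ρ σ u + nrm ρ σ v := by
  ext x
  simp [nrm_apply, Finset.sum_add_distrib]

lemma nrm_neg (u : V →ₗ[k] V₂) : nrm ρ σ (-u) = - nrm ρ σ u := by
  ext x
  simp [nrm_apply]

lemma nrm_sub (u v : V →ₗ[k] V₂) : nrm ρ σ (u - v) = nrm ρ σ u - nrm ρ σ v := by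
  rw [sub_eq_add_neg, nrm_add, nrm_neg, sub_eq_add_neg]

lemma nrm_eqv (u : V →ₗ[k] V₂) : Eqv ρ σ (nrm ρ σ u) := by
  intro h x
  simp only [nrm_apply, map_sum]
  refine Fintype.sum_equiv (Equiv.mulLeft h⁻¹) _ _ fun g => ?_
  simp only [Equiv.coe_mulLeft, ← Module.End.mul_apply, ← map_mul]
  simp

variable (ρ σ) in
/-- Stable equivalence. -/
def SIso : Prop := ∃ (f : V →ₗ[k] V₂) (h : V₂ →ₗ[k] V) (u : V →ₗ[k] V) (w : V₂ →ₗ[k] V₂),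
  Eqv ρ σ f ∧ Eqv σ ρ h ∧ h ∘ₗ f = LinearMap.id + nrm ρ ρ u ∧ f ∘ₗ h = LinearMap.id + nrm σ σ w

lemma SIso.symm : SIso ρ σ → SIso σ ρ := by
  rintro ⟨f, h, u, w, hf, hh, h1, h2⟩
  exact ⟨h, f, w, u, hh, hf, h2, h1⟩

lemma SIso.refl : SIso ρ ρ :=
  ⟨LinearMap.id, LinearMap.id, 0, 0, Eqv.id, Eqv.id, by ext x; simp [nrm_apply],
    by ext x; simp [nrm_apply]⟩

lemma SIso.of_equiv (e : V ≃ₗ[k] V₂) (he : Eqv ρ σ e.toLinearMap) : SIso ρ σ := by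
  refine ⟨e, e.symm, 0, 0, he, ?_, by ext x; simp [nrm_apply], by ext x; simp [nrm_apply]⟩
  intro g x
  apply e.injective
  have := he g (e.symm x)
  simp at this
  simp [this]

lemma siso_aux {f : V →ₗ[k] V₂} {h : V₂ →ₗ[k] V} {u : V →ₗ[k] V}
    {f' : V₂ →ₗ[k] V₃} {h' : V₃ →ₗ[k] V₂} {u' : V₂ →ₗ[k] V₂}
    (hf : Eqv ρ σ f) (hh : Eqv σ ρ h)
    (e : h ∘ₗ f = LinearMap.id + nrm ρ ρ u) (e' : h' ∘ₗ f' = LinearMap.id + nrm σ σ u') :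
    (h ∘ₗ h') ∘ₗ (f' ∘ₗ f) = LinearMap.id + nrm ρ ρ (u + h ∘ₗ u' ∘ₗ f) := by
  calc (h ∘ₗ h') ∘ₗ (f' ∘ₗ f) = h ∘ₗ (h' ∘ₗ f') ∘ₗ f := by simp [LinearMap.comp_assoc]
    _ = h ∘ₗ f + h ∘ₗ nrm σ σ u' ∘ₗ f := by
      rw [e', LinearMap.add_comp, LinearMap.comp_add, LinearMap.id_comp]
    _ = _ := by rw [nrm_comp hf, comp_nrm hh, e, nrm_add, add_assoc]

lemma SIso.trans : SIso ρ σ → SIso σ τ → SIso ρ τ := by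
  rintro ⟨f, h, u, w, hf, hh, h1, h2⟩ ⟨f', h', u', w', hf', hh', h1', h2'⟩
  exact ⟨f' ∘ₗ f, h ∘ₗ h', _, _, hf'.comp hf, hh.comp hh', siso_aux hf hh h1 h1',
    siso_aux hh' hf' h2' h2⟩


lemma Eqv.rT {f : V →ₗ[k] V₂} (hf : Eqv ρ σ f) :
    Eqv (ρ.tprod τ) (σ.tprod τ) (f.rTensor V₃) := by
  intro g x
  induction x with
  | zero => simp
  | add x y hx hy => simp only [map_add, hx, hy]
  | tmul x y => simp [hf g x]

lemma nrm_rT (u : V →ₗ[k] V₂) :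
    (nrm ρ σ u).rTensor V₃ = nrm (ρ.tprod τ) (σ.tprod τ) (u.rTensor V₃) := by
  refine TensorProduct.ext' fun x y => ?_
  simp [nrm_apply, TensorProduct.sum_tmul]

lemma SIso.rT (τ : Representation k G V₃) : SIso ρ σ → SIso (ρ.tprod τ) (σ.tprod τ) := by
  rintro ⟨f, h, u, w, hf, hh, h1, h2⟩
  refine ⟨f.rTensor V₃, h.rTensor V₃, u.rTensor V₃, w.rTensor V₃, hf.rT, hh.rT, ?_, ?_⟩
  · rw [← LinearMap.rTensor_comp, h1, LinearMap.rTensor_add, nrm_rT, LinearMap.rTensor_id]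
  · rw [← LinearMap.rTensor_comp, h2, LinearMap.rTensor_add, nrm_rT, LinearMap.rTensor_id]

lemma SIso.tcomm (ρ : Representation k G V) (σ : Representation k G V₂) :
    SIso (ρ.tprod σ) (σ.tprod ρ) := by
  refine SIso.of_equiv (TensorProduct.comm k V V₂) ?_
  intro g x
  induction x with
  | zero => simp
  | add x y hx hy => simp only [map_add, hx, hy]
  | tmul x y => simp

lemma SIso.lT (τ : Representation k G V₃) (h : SIso ρ σ) : SIso (τ.tprod ρ) (τ.tprod σ) :=
  (SIso.tcomm τ ρ).trans ((h.rT τ).trans (SIso.tcomm σ τ))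

lemma SIso.tassoc (ρ : Representation k G V) (σ : Representation k G V₂)
    (τ : Representation k G V₃) :
    SIso ((ρ.tprod σ).tprod τ) (ρ.tprod (σ.tprod τ)) := by
  refine SIso.of_equiv (TensorProduct.assoc k V V₂ V₃) ?_
  intro g x
  have : (TensorProduct.assoc k V V₂ V₃).toLinearMap ∘ₗ ((ρ.tprod σ).tprod τ) g
      = (ρ.tprod (σ.tprod τ)) g ∘ₗ (TensorProduct.assoc k V V₂ V₃).toLinearMap := by
    refine TensorProduct.ext_threefold fun x y z => by simp
  exact LinearMap.congr_fun this x

lemma eqv_lid (ρ : Representation k G V) :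
    Eqv ((Representation.trivial k G k).tprod ρ) ρ (TensorProduct.lid k V).toLinearMap := by
  intro g x
  induction x with
  | zero => simp
  | add x y hx hy => simp only [map_add, hx, hy]
  | tmul x y => simp

lemma SIso.tlid (ρ : Representation k G V) :
    SIso ((Representation.trivial k G k).tprod ρ) ρ :=
  SIso.of_equiv _ (eqv_lid ρ)

/-! Syzygies -/

/-- A split-over-`k` short exact sequence with relatively projective middle term. -/
structure Syz (ρ : Representation k G V) (σ : Representation k G V₂)
    (τ : Representation k G V₃) where
  i : V →ₗ[k] V₂
  p : V₂ →ₗ[k] V₃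
  s : V₃ →ₗ[k] V₂
  t : V₂ →ₗ[k] V
  n : V₂ →ₗ[k] V₂
  hi : Eqv ρ σ i
  hp : Eqv σ τ p
  ti : t ∘ₗ i = LinearMap.id
  ps : p ∘ₗ s = LinearMap.id
  pi : p ∘ₗ i = 0
  sum : i ∘ₗ t + s ∘ₗ p = LinearMap.id
  hn : nrm σ σ n = LinearMap.id

namespace Syz

lemma ti' (S : Syz ρ σ τ) (x) : S.t (S.i x) = x := LinearMap.congr_fun S.ti x
lemma ps' (S : Syz ρ σ τ) (x) : S.p (S.s x) = x := LinearMap.congr_fun S.ps x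
lemma pi' (S : Syz ρ σ τ) (x) : S.p (S.i x) = 0 := LinearMap.congr_fun S.pi x
lemma sum' (S : Syz ρ σ τ) (x) : S.i (S.t x) + S.s (S.p x) = x := LinearMap.congr_fun S.sum x
lemma ts' (S : Syz ρ σ τ) (x) : S.t (S.s x) = 0 := by
  have := congrArg S.t (S.sum' (S.s x))
  simpa [S.ti', S.ps'] using this
lemma inj (S : Syz ρ σ τ) : Function.Injective S.i := fun x y h => by
  rw [← S.ti' x, h, S.ti']

noncomputable def rT (S : Syz ρ σ τ) (υ : Representation k G V₄) :
    Syz (ρ.tprod υ) (σ.tprod υ) (τ.tprod υ) where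
  i := S.i.rTensor V₄
  p := S.p.rTensor V₄
  s := S.s.rTensor V₄
  t := S.t.rTensor V₄
  n := S.n.rTensor V₄
  hi := S.hi.rT
  hp := S.hp.rT
  ti := by rw [← LinearMap.rTensor_comp, S.ti, LinearMap.rTensor_id]
  ps := by rw [← LinearMap.rTensor_comp, S.ps, LinearMap.rTensor_id]
  pi := by rw [← LinearMap.rTensor_comp, S.pi, LinearMap.rTensor_zero]
  sum := by rw [← LinearMap.rTensor_comp, ← LinearMap.rTensor_comp, ← LinearMap.rTensor_add,
    S.sum, LinearMap.rTensor_id]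
  hn := by rw [← nrm_rT, S.hn, LinearMap.rTensor_id]

/-- Transport along an isomorphism of the quotient. -/
noncomputable def congrQ (S : Syz ρ σ τ) (e : V₃ ≃ₗ[k] V₄) (he : Eqv τ υ e.toLinearMap) :
    Syz ρ σ υ where
  i := S.i
  p := e.toLinearMap ∘ₗ S.p
  s := S.s ∘ₗ e.symm.toLinearMap
  t := S.t
  n := S.n
  hi := S.hi
  hp := he.comp S.hp
  ti := S.ti
  ps := by ext x; simp [S.ps']
  pi := by ext x; simp [S.pi']
  sum := by ext x; simp [S.sum']
  hn := S.hn

lemma eqv_lcomp {f : V →ₗ[k] V₂} (hf : Eqv ρ σ f) :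
    Eqv (σ.linHom τ) (ρ.linHom τ) (LinearMap.lcomp k V₃ f) := by
  intro g u
  ext x
  simp [hf _ _]

/-- The dual sequence. -/
noncomputable def dual (S : Syz ρ σ τ) (υ : Representation k G V₄) :
    Syz (τ.linHom υ) (σ.linHom υ) (ρ.linHom υ) where
  i := LinearMap.lcomp k V₄ S.p
  p := LinearMap.lcomp k V₄ S.i
  s := LinearMap.lcomp k V₄ S.t
  t := LinearMap.lcomp k V₄ S.s
  n := LinearMap.lcomp k V₄ S.n
  hi := eqv_lcomp S.hp
  hp := eqv_lcomp S.hi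
  ti := by ext u x; simp [S.ps']
  ps := by ext u x; simp [S.ti']
  pi := by ext u x; simp [S.pi']
  sum := by
    ext u x
    simp only [LinearMap.add_apply, LinearMap.comp_apply, LinearMap.lcomp_apply, LinearMap.id_apply]
    rw [← map_add, add_comm, S.sum']
  hn := by
    ext u x
    have := congrArg u (LinearMap.congr_fun S.hn x)
    rw [nrm_apply, map_sum] at this
    rw [nrm_apply, LinearMap.sum_apply]
    refine Eq.trans ?_ this
    refine Finset.sum_congr rfl fun g _ => ?_
    simp

/-- Comparison of two syzygy sequences with the same quotient. -/
lemma lift (S : Syz ρ σ τ) (S' : Syz υ ω τ) :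
    ∃ (a : V₂ →ₗ[k] V₅) (b : V →ₗ[k] V₄), Eqv σ ω a ∧ Eqv ρ υ b ∧ S'.p ∘ₗ a = S.p ∧
      S'.i ∘ₗ b = a ∘ₗ S.i := by
  let a := nrm σ ω (S'.s ∘ₗ S.p ∘ₗ S.n)
  have ha : Eqv σ ω a := nrm_eqv _
  have pa : S'.p ∘ₗ a = S.p := by
    rw [comp_nrm S'.hp, ← LinearMap.comp_assoc, S'.ps, LinearMap.id_comp, ← comp_nrm S.hp, S.hn,
      LinearMap.comp_id]
  have pa' : ∀ x, S'.p (a x) = S.p x := LinearMap.congr_fun pa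
  have ib : ∀ x, S'.i (S'.t (a (S.i x))) = a (S.i x) := fun x => by
    have := S'.sum' (a (S.i x))
    rwa [pa', S.pi', map_zero, add_zero] at this
  refine ⟨a, S'.t ∘ₗ a ∘ₗ S.i, ha, ?_, pa, ?_⟩
  · intro g x
    apply S'.inj
    simp only [LinearMap.comp_apply]
    rw [ib, S'.hi, ib, S.hi, ha]
  · ext x
    exact ib x

lemma lift_aux (S : Syz ρ σ τ) (a : V₂ →ₗ[k] V₂) (b : V →ₗ[k] V) (ha : Eqv σ σ a)
    (pa : S.p ∘ₗ a = S.p) (hb : S.i ∘ₗ b = a ∘ₗ S.i) :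
    ∃ u, b = LinearMap.id + nrm ρ ρ u := by
  let c : V₂ →ₗ[k] V := S.t ∘ₗ (a - LinearMap.id)
  have pa' : ∀ x, S.p (a x) = S.p x := LinearMap.congr_fun pa
  have hb' : ∀ x, S.i (b x) = a (S.i x) := LinearMap.congr_fun hb
  have ic : ∀ x, S.i (c x) = a x - x := fun x => by
    have := S.sum' (a x - x)
    rw [map_sub S.p, pa', sub_self, map_zero, add_zero] at this
    exact this
  have hc : Eqv σ ρ c := by
    intro g x
    apply S.inj
    rw [ic, S.hi, ic, ha, map_sub]
  refine ⟨c ∘ₗ S.n ∘ₗ S.i, ?_⟩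
  rw [← comp_nrm hc, ← nrm_comp S.hi, S.hn]
  ext x
  apply S.inj
  simp [hb', ic]

/-- Schanuel's lemma, stable form. -/
lemma schanuel (S : Syz ρ σ τ) (S' : Syz υ ω τ) : SIso ρ υ := by
  obtain ⟨a, b, ha, hb, pa, ib⟩ := S.lift S'
  obtain ⟨a', b', ha', hb', pa', ib'⟩ := S'.lift S
  obtain ⟨u, hu⟩ := S.lift_aux (a' ∘ₗ a) (b' ∘ₗ b) (ha'.comp ha)
    (by rw [← LinearMap.comp_assoc, pa', pa])
    (by rw [← LinearMap.comp_assoc, ib', LinearMap.comp_assoc, ib, LinearMap.comp_assoc])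
  obtain ⟨w, hw⟩ := S'.lift_aux (a ∘ₗ a') (b ∘ₗ b') (ha.comp ha')
    (by rw [← LinearMap.comp_assoc, pa, pa'])
    (by rw [← LinearMap.comp_assoc, ib, LinearMap.comp_assoc, ib', LinearMap.comp_assoc])
  exact ⟨b, b', u, w, hb, hb', hu, hw⟩

/-- The pushout representation on `V₄ × V₃`. -/
noncomputable def poRep (S : Syz ρ σ τ) {f : V →ₗ[k] V₄} (hf : Eqv ρ υ f) :
    Representation k G (V₄ × V₃) where
  toFun g := LinearMap.prod (υ g ∘ₗ LinearMap.fst k V₄ V₃ +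
    f ∘ₗ S.t ∘ₗ σ g ∘ₗ S.s ∘ₗ LinearMap.snd k V₄ V₃) (τ g ∘ₗ LinearMap.snd k V₄ V₃)
  map_one' := by
    apply LinearMap.ext
    rintro ⟨x, y⟩
    simp [S.ts']
  map_mul' g h := by
    apply LinearMap.ext
    rintro ⟨x, y⟩
    have h1 := S.sum' (σ h (S.s y))
    rw [S.hp, S.ps'] at h1
    have h2 : S.t (σ g (σ h (S.s y))) = ρ g (S.t (σ h (S.s y))) + S.t (σ g (S.s (τ h y))) := by
      conv_lhs => rw [← h1]
      rw [map_add, map_add, ← S.hi, S.ti']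
    simp [h2, hf _ _, add_assoc]

lemma poRep_apply (S : Syz ρ σ τ) {f : V →ₗ[k] V₄} (hf : Eqv ρ υ f) (g x y) :
    S.poRep hf g (x, y) = (υ g x + f (S.t (σ g (S.s y))), τ g y) := rfl

lemma pushout (S : Syz ρ σ τ) (h : SIso ρ υ) :
    ∃ (π : Representation k G (V₄ × V₃)), Nonempty (Syz υ π τ) := by
  obtain ⟨f, h, u, w, hf, hh, h1, h2⟩ := h
  refine ⟨S.poRep hf, ⟨?_⟩⟩
  have h1' : ∀ x, h (f x) = x + nrm ρ ρ u x := LinearMap.congr_fun h1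
  let β : V₂ →ₗ[k] V := nrm σ ρ ((-u) ∘ₗ S.t)
  have hβ : Eqv σ ρ β := nrm_eqv _
  have βi : ∀ x, β (S.i x) = x - h (f x) := by
    intro x
    have : β ∘ₗ S.i = - nrm ρ ρ u := by
      rw [nrm_comp S.hi, LinearMap.comp_assoc, S.ti, LinearMap.comp_id, nrm_neg]
    rw [h1', show β (S.i x) = - nrm ρ ρ u x from LinearMap.congr_fun this x]
    abel
  let j : V₄ →ₗ[k] V₄ × V₃ := LinearMap.inl k V₄ V₃
  have hj : Eqv υ (S.poRep hf) j := by
    intro g x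
    simp [j, poRep_apply]
  let q : V₂ →ₗ[k] V₄ × V₃ := LinearMap.prod (f ∘ₗ S.t) S.p
  have hs : ∀ g x, σ g (S.s x) = S.i (S.t (σ g (S.s x))) + S.s (τ g x) := by
    intro g x
    have := S.sum' (σ g (S.s x))
    rw [S.hp, S.ps'] at this
    exact this.symm
  have hq : Eqv σ (S.poRep hf) q := by
    intro g x
    have h3 : S.t (σ g x) = ρ g (S.t x) + S.t (σ g (S.s (S.p x))) := by
      conv_lhs => rw [← S.sum' x]
      rw [map_add, map_add, ← S.hi, S.ti']
    simp [q, poRep_apply, S.hp g x, h3, hf g]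
  let sF : V₄ × V₃ →ₗ[k] V₂ := LinearMap.coprod (S.i ∘ₗ h) ((LinearMap.id - S.i ∘ₗ β) ∘ₗ S.s)
  have hsF : Eqv (S.poRep hf) σ sF := by
    rintro g ⟨x, y⟩
    have e := hs g y
    have e2 := congrArg β e
    rw [hβ, map_add, βi] at e2
    simp only [sF, poRep_apply, LinearMap.coprod_apply, LinearMap.comp_apply, map_add,
      LinearMap.sub_apply, LinearMap.id_apply, map_sub, ← S.hi g, ← hh g, e2]
    generalize S.t (σ g (S.s y)) = c at e
    rw [e]
    abel
  let sX : V₄ × V₃ →ₗ[k] V₄ := LinearMap.coprod (LinearMap.id - f ∘ₗ h) (f ∘ₗ β ∘ₗ S.s)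
  have hsX : Eqv (S.poRep hf) υ sX := by
    rintro g ⟨x, y⟩
    have e := hs g y
    have e2 := congrArg β e
    rw [hβ, map_add, βi] at e2
    simp only [sX, poRep_apply, LinearMap.coprod_apply, LinearMap.comp_apply, map_add,
      LinearMap.sub_apply, LinearMap.id_apply, map_sub, ← hf g, ← hh g, e2]
    abel
  -- the inclusion is a norm
  let v : V₄ →ₗ[k] V₄ × V₃ := q ∘ₗ S.n ∘ₗ S.i ∘ₗ h - j ∘ₗ w
  have hv : nrm υ (S.poRep hf) v = j := by
    rw [nrm_sub, ← comp_nrm hj, ← comp_nrm hq, ← nrm_comp (S.hi.comp hh), S.hn,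
      LinearMap.id_comp]
    have h2' : nrm υ υ w = f ∘ₗ h - LinearMap.id := by rw [h2]; abel
    rw [h2']
    ext x <;> simp [q, j, S.ti', S.pi']
  exact
  { i := j
    p := LinearMap.snd k V₄ V₃
    s := LinearMap.inr k V₄ V₃
    t := LinearMap.fst k V₄ V₃
    n := q ∘ₗ S.n ∘ₗ sF + v ∘ₗ sX
    hi := hj
    hp := fun g ⟨x, y⟩ => by simp [poRep_apply]
    ti := by ext x; simp [j]
    ps := by ext x; simp
    pi := by ext x; simp [j]
    sum := by ext x <;> simp [j]
    hn := by
      rw [nrm_add, ← comp_nrm hq, ← nrm_comp hsF, ← nrm_comp hsX, hv, S.hn, LinearMap.id_comp]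
      apply LinearMap.ext
      rintro ⟨x, y⟩
      have e : f (h x) + -f (β (S.s y)) + (x - f (h x) + f (β (S.s y))) = x := by abel
      simp [q, sF, sX, j, e, S.ti', S.pi', S.ts', S.ps'] }

end Syz

end Stable

/-! ### Projectivity -/

section Proj

variable {k : Type} [CommRing k] {G : Type} [Group G] [Fintype G]
variable {V : Type} [AddCommGroup V] [Module k V] {ρ : Representation k G V}

lemma lincomb_eqv :
    ∀ (g : G) (x : ρ.asModule →₀ MonoidAlgebra k G),
      (Finsupp.linearCombination (MonoidAlgebra k G) (id : ρ.asModule → ρ.asModule))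
        (MonoidAlgebra.single g (1 : k) • x) =
      ρ g (ρ.asModuleEquiv ((Finsupp.linearCombination (MonoidAlgebra k G)
        (id : ρ.asModule → ρ.asModule)) x)) := by
  intro g x
  rw [map_smul, Representation.single_smul, one_smul]

lemma projective_of_norm [Module.Projective k V] (n : V →ₗ[k] V)
    (hn : nrm ρ ρ n = LinearMap.id) :
    Module.Projective (MonoidAlgebra k G) ρ.asModule := by
  let F := ρ.asModule →₀ MonoidAlgebra k G
  let L : F →ₗ[MonoidAlgebra k G] ρ.asModule := Finsupp.linearCombination (MonoidAlgebra k G) id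
  let L' : F →ₗ[k] V := ρ.asModuleEquiv.toLinearMap ∘ₗ L.restrictScalars k
  have hL : Function.Surjective L' := fun v => by
    refine ⟨Finsupp.single (ρ.asModuleEquiv.symm v) 1, ?_⟩
    have e : L (Finsupp.single (ρ.asModuleEquiv.symm v) 1) =
        (1 : MonoidAlgebra k G) • (ρ.asModuleEquiv.symm v : ρ.asModule) :=
      Finsupp.linearCombination_single _ _ _
    rw [one_smul] at e
    exact e
  obtain ⟨s, hs⟩ := LinearMap.exists_rightInverse_of_surjective L' (LinearMap.range_eq_top.2 hL)
  let τ : Representation k G F := Representation.ofModule' F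
  have hτ : ∀ g x, τ g x = MonoidAlgebra.single g (1 : k) • x := by
    intro g x
    simp [τ, Representation.ofModule']
  have hLe : Eqv τ ρ L' := by
    intro g x
    rw [hτ]
    exact lincomb_eqv g x
  let S := nrm ρ τ (s ∘ₗ n)
  have hS : L' ∘ₗ S = LinearMap.id := by
    rw [comp_nrm hLe, ← LinearMap.comp_assoc, hs, LinearMap.id_comp, hn]
  have hSe : Eqv ρ τ S := nrm_eqv _
  let S' : ρ.asModule →ₗ[k] F := S ∘ₗ ρ.asModuleEquiv.toLinearMap
  let T : ρ.asModule →ₗ[MonoidAlgebra k G] F := MonoidAlgebra.equivariantOfLinearOfComm S' (by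
    intro g v
    rw [← hτ, Representation.single_smul, one_smul]
    exact hSe g _)
  refine Module.Projective.of_split T L ?_
  ext v
  exact LinearMap.congr_fun hS v

lemma norm_of_projective (h : Module.Projective (MonoidAlgebra k G) ρ.asModule) :
    Module.Projective k V ∧ ∃ n : V →ₗ[k] V, nrm ρ ρ n = LinearMap.id := by
  obtain ⟨s, hs⟩ := Module.projective_def'.1 h
  let F := ρ.asModule →₀ MonoidAlgebra k G
  let L : F →ₗ[MonoidAlgebra k G] ρ.asModule := Finsupp.linearCombination (MonoidAlgebra k G) id
  let L' : F →ₗ[k] V := ρ.asModuleEquiv.toLinearMap ∘ₗ L.restrictScalars k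
  let s' : V →ₗ[k] F := s.restrictScalars k ∘ₗ ρ.asModuleEquiv.symm.toLinearMap
  have hs' : L' ∘ₗ s' = LinearMap.id := by
    ext v
    exact LinearMap.congr_fun hs v
  constructor
  · have : Module.Free k (MonoidAlgebra k G) :=
      Module.Free.of_equiv (MonoidAlgebra.coeffLinearEquiv (M := G) (S := k) k).symm
    exact Module.Projective.of_split s' L' hs'
  · let c : MonoidAlgebra k G →ₗ[k] k :=
      Finsupp.lapply 1 ∘ₗ (MonoidAlgebra.coeffLinearEquiv (M := G) (S := k) k).toLinearMap
    let L0 : F →ₗ[k] V := ρ.asModuleEquiv.toLinearMap ∘ₗ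
      Finsupp.linearCombination k (id : ρ.asModule → ρ.asModule) ∘ₗ Finsupp.mapRange.linearMap c
    have key : ∀ f : F, ∑ g : G, ρ g (L0 (MonoidAlgebra.single g⁻¹ (1 : k) • f)) = L' f := by
      intro f
      induction f using Finsupp.induction_linear with
      | zero => simp
      | add x y hx hy => simp only [smul_add, map_add, Finset.sum_add_distrib, hx, hy]
      | single m a =>
        induction a using MonoidAlgebra.induction_linear with
        | zero => simp
        | add x y hx hy =>
          simp only [Finsupp.single_add, smul_add, map_add, Finset.sum_add_distrib, hx, hy]
        | single h r =>
          classical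
          have e1 : ∀ g : G, ρ g (L0 (MonoidAlgebra.single g⁻¹ (1 : k) •
              (Finsupp.single m (MonoidAlgebra.single h r) : F))) =
              if g = h then r • ρ g (ρ.asModuleEquiv m) else 0 := by
            intro g
            simp only [L0, F, LinearMap.comp_apply, Finsupp.smul_single, smul_eq_mul,
              MonoidAlgebra.single_mul_single, one_mul, Finsupp.mapRange.linearMap_apply,
              Finsupp.mapRange_single, Finsupp.linearCombination_single, id]
            have e2 : c (MonoidAlgebra.single (g⁻¹ * h) r) = if g = h then r else 0 := by
              simp only [c, LinearMap.comp_apply]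
              show (MonoidAlgebra.single (g⁻¹ * h) r).coeff 1 = _
              rw [MonoidAlgebra.coeff_single, Finsupp.single_apply]
              simp only [inv_mul_eq_one]
            rw [e2]
            split_ifs <;> simp
          rw [Finset.sum_congr rfl fun g _ => e1 g]
          rw [Finset.sum_ite_eq' Finset.univ h, if_pos (Finset.mem_univ h)]
          have e3 : L (Finsupp.single m (MonoidAlgebra.single h r)) =
              MonoidAlgebra.single h r • m := Finsupp.linearCombination_single _ _ _
          rw [Representation.single_smul] at e3
          exact e3.symm
    refine ⟨L0 ∘ₗ s', ?_⟩
    ext v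
    rw [nrm_apply]
    rw [← hs']
    simp only [LinearMap.comp_apply]
    rw [← key (s' v)]
    refine Finset.sum_congr rfl fun g _ => ?_
    congr 2
    have := s.map_smul (MonoidAlgebra.single g⁻¹ (1 : k)) (ρ.asModuleEquiv.symm v)
    rw [Representation.single_smul, one_smul] at this
    exact this

end Proj

/-! ### The augmentation sequence and the modules `J n` -/

section Aug

variable (G : Type) [Group G] [Fintype G]

/-- The regular representation on finitely supported functions. -/
noncomputable def regρ : Representation ℤ G (G →₀ ℤ) where
  toFun g := Finsupp.lmapDomain ℤ ℤ (g • · : G → G)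
  map_one' := by
    ext x
    simp
  map_mul' g h := by
    ext x
    simp [mul_assoc]

/-- The retraction onto the augmentation ideal. -/
noncomputable def augT : (G →₀ ℤ) →ₗ[ℤ] IGcar G :=
  (LinearMap.id - Finsupp.lsingle 1 ∘ₗ aug G).codRestrict (LinearMap.ker (aug G)) (by
    intro x
    simp [aug])

lemma augT_coe (x : G →₀ ℤ) : (augT G x : G →₀ ℤ) = x - Finsupp.single 1 (aug G x) := rfl

/-- The augmentation sequence. -/
noncomputable def augSyz : Syz (IGρ G) (regρ G) (Representation.trivial ℤ G ℤ) where
  i := (LinearMap.ker (aug G)).subtype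
  p := aug G
  s := Finsupp.lsingle 1
  t := augT G
  n := Finsupp.lsingle 1 ∘ₗ Finsupp.lapply 1
  hi := fun g x => rfl
  hp := fun g x => aug_comm G g x
  ti := by
    apply LinearMap.ext
    intro x
    apply Subtype.ext
    have hx : aug G (x : G →₀ ℤ) = 0 := x.2
    simp [augT_coe, hx]
  ps := by
    ext
    simp [aug]
  pi := by
    ext x
    simp
  sum := by
    apply LinearMap.ext
    intro x
    simp [augT_coe]
  hn := by
    apply Finsupp.lhom_ext
    intro h z
    classical
    rw [nrm_apply]
    have : ∀ g : G, regρ G g ((Finsupp.lsingle 1 ∘ₗ Finsupp.lapply 1 :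
        (G →₀ ℤ) →ₗ[ℤ] (G →₀ ℤ)) (regρ G g⁻¹ (Finsupp.single h z))) = if g = h then Finsupp.single g z else 0 := by
      intro g
      simp only [regρ, MonoidHom.coe_mk, OneHom.coe_mk, LinearMap.comp_apply,
        Finsupp.lmapDomain_apply, Finsupp.mapDomain_single, Finsupp.lapply_apply,
        Finsupp.lsingle_apply, Finsupp.single_apply, smul_eq_mul, inv_mul_eq_one, mul_one]
      split_ifs <;> simp
    rw [Finset.sum_congr rfl fun g _ => this g]
    simp

/-- The augmentation sequence, tensored with a representation. -/
noncomputable def augSyzT {V : Type} [AddCommGroup V] [Module ℤ V] (ρ : Representation ℤ G V) :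
    Syz (k := ℤ) (V := IGcar G ⊗[ℤ] V) (V₂ := (G →₀ ℤ) ⊗[ℤ] V)
      ((IGρ G).tprod ρ) ((regρ G).tprod ρ) ρ :=
  ((augSyz G).rT ρ).congrQ (TensorProduct.lid ℤ V) (eqv_lid ρ)

variable {G}

/-- Stable equivalence for objects of `Rep`. -/
def SR (X Y : Rep.{0} ℤ G) : Prop := SIso X.ρ Y.ρ

lemma SR.refl (X : Rep.{0} ℤ G) : SR X X := SIso.refl
lemma SR.symm {X Y : Rep.{0} ℤ G} (h : SR X Y) : SR Y X := SIso.symm h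
lemma SR.trans {X Y Z : Rep.{0} ℤ G} (h : SR X Y) (h' : SR Y Z) : SR X Z := SIso.trans h h'
lemma SR.rT {X Y : Rep.{0} ℤ G} (h : SR X Y) (Z : Rep.{0} ℤ G) : SR (X ⊗ Z) (Y ⊗ Z) :=
  SIso.rT Z.ρ h
lemma SR.lT {X Y : Rep.{0} ℤ G} (h : SR X Y) (Z : Rep.{0} ℤ G) : SR (Z ⊗ X) (Z ⊗ Y) :=
  SIso.lT Z.ρ h
lemma SR.assoc (X Y Z : Rep.{0} ℤ G) : SR ((X ⊗ Y) ⊗ Z) (X ⊗ (Y ⊗ Z)) :=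
  SIso.tassoc X.ρ Y.ρ Z.ρ
lemma SR.comm (X Y : Rep.{0} ℤ G) : SR (X ⊗ Y) (Y ⊗ X) := SIso.tcomm X.ρ Y.ρ
lemma SR.lid (X : Rep.{0} ℤ G) : SR (𝟙_ (Rep.{0} ℤ G) ⊗ X) X := SIso.tlid X.ρ
lemma SR.rid (X : Rep.{0} ℤ G) : SR (X ⊗ 𝟙_ (Rep.{0} ℤ G)) X := (SR.comm _ _).trans (SR.lid X)

lemma SR.ID : SR (IGrep G ⊗ DIG G) (𝟙_ (Rep.{0} ℤ G)) := by
  have h1 : SIso (k := ℤ) (V := IGcar G ⊗[ℤ] (DIG G).V) (V₂ := ℤ →ₗ[ℤ] ℤ)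
      ((IGρ G).tprod (DIG G).ρ)
      ((Representation.trivial ℤ G ℤ).linHom (Representation.trivial ℤ G ℤ)) :=
    (augSyzT G (DIG G).ρ).schanuel ((augSyz G).dual (Representation.trivial ℤ G ℤ))
  refine SIso.trans h1 ?_
  refine SIso.of_equiv (LinearMap.ringLmapEquivSelf ℤ ℤ ℤ) ?_
  intro g x
  rfl

lemma SR.DI : SR (DIG G ⊗ IGrep G) (𝟙_ (Rep.{0} ℤ G)) := (SR.comm _ _).trans SR.ID

lemma SR.J_succ : ∀ n : ℤ, SR (J G (n + 1)) (J G n ⊗ IGrep G)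
  | .ofNat m => SR.refl (Jp G m ⊗ IGrep G)
  | .negSucc 0 => by
    show SR (𝟙_ (Rep.{0} ℤ G)) ((𝟙_ (Rep.{0} ℤ G) ⊗ DIG G) ⊗ IGrep G)
    exact (((SR.lid (DIG G)).rT _).trans SR.DI).symm
  | .negSucc (m+1) => by
    show SR (Jn G (m+1)) ((Jn G (m+1) ⊗ DIG G) ⊗ IGrep G)
    exact (((SR.assoc _ _ _).trans (SR.DI.lT _)).trans (SR.rid _)).symm

lemma SR.J_add (n : ℤ) : ∀ m : ℕ, SR (J G (n + m)) (J G n ⊗ Jp G m)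
  | 0 => by
    have : n + ((0 : ℕ) : ℤ) = n := by simp
    rw [this]
    exact (SR.rid _).symm
  | m + 1 => by
    have : n + ((m + 1 : ℕ) : ℤ) = (n + m) + 1 := by push_cast; ring
    rw [this]
    exact ((SR.J_succ _).trans ((SR.J_add n m).rT _)).trans (SR.assoc _ _ _)

lemma SR.I_cancel {X Y : Rep.{0} ℤ G} (h : SR (IGrep G ⊗ X) (IGrep G ⊗ Y)) : SR X Y := by
  have aux : ∀ Z : Rep.{0} ℤ G, SR (DIG G ⊗ (IGrep G ⊗ Z)) Z := fun Z =>
    ((SR.assoc _ _ _).symm.trans (SR.DI.rT Z)).trans (SR.lid Z)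
  exact ((aux X).symm.trans (h.lT _)).trans (aux Y)

lemma SR.D_cancel {X Y : Rep.{0} ℤ G} (h : SR (DIG G ⊗ X) (DIG G ⊗ Y)) : SR X Y := by
  have aux : ∀ Z : Rep.{0} ℤ G, SR (IGrep G ⊗ (DIG G ⊗ Z)) Z := fun Z =>
    ((SR.assoc _ _ _).symm.trans (SR.ID.rT Z)).trans (SR.lid Z)
  exact ((aux X).symm.trans (h.lT _)).trans (aux Y)

lemma SR.Jp_cancel : ∀ (n : ℕ) {X Y : Rep.{0} ℤ G}, SR (Jp G n ⊗ X) (Jp G n ⊗ Y) → SR X Y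
  | 0, X, Y, h => ((SR.lid X).symm.trans h).trans (SR.lid Y)
  | n + 1, _, _, h => SR.I_cancel (SR.Jp_cancel n
      (((SR.assoc _ _ _).symm.trans h).trans (SR.assoc _ _ _)))

lemma SR.Jn_cancel : ∀ (n : ℕ) {X Y : Rep.{0} ℤ G}, SR (Jn G n ⊗ X) (Jn G n ⊗ Y) → SR X Y
  | 0, X, Y, h => ((SR.lid X).symm.trans h).trans (SR.lid Y)
  | n + 1, _, _, h => SR.D_cancel (SR.Jn_cancel n
      (((SR.assoc _ _ _).symm.trans h).trans (SR.assoc _ _ _)))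

lemma SR.J_cancel {X Y : Rep.{0} ℤ G} : ∀ n : ℤ, SR (J G n ⊗ X) (J G n ⊗ Y) → SR X Y
  | .ofNat n => SR.Jp_cancel n
  | .negSucc n => SR.Jn_cancel (n + 1)

lemma SR.shift {X X' : Rep.{0} ℤ G} (i : ℤ) (r : ℕ)
    (h : SR (J G i ⊗ X) (J G (i + r) ⊗ X')) : SR X (Jp G r ⊗ X') :=
  SR.J_cancel i ((h.trans ((SR.J_add i r).rT X')).trans (SR.assoc _ _ _))

end Aug

/-! ### Tate classes and stable maps -/

section Cls

variable {k : Type} [CommRing k] {G : Type} [Group G] [Fintype G]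
variable {U V W : Type} [AddCommGroup U] [Module k U] [AddCommGroup V] [Module k V]
  [AddCommGroup W] [Module k W]
  {ρ : Representation k G U} {σ : Representation k G V} {τ : Representation k G W}

lemma curry_conj (g : G) (f : U ⊗[k] V →ₗ[k] W) :
    (ρ.linHom (σ.linHom τ)) g (TensorProduct.curry f) =
      TensorProduct.curry (τ g ∘ₗ f ∘ₗ (ρ.tprod σ) g⁻¹) := by
  ext x y
  rfl

lemma curry_mem {f : U ⊗[k] V →ₗ[k] W} (hf : Eqv (ρ.tprod σ) τ f) :
    TensorProduct.curry f ∈ (ρ.linHom (σ.linHom τ)).invariants := by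
  intro g
  rw [curry_conj]
  congr 1
  apply LinearMap.ext
  intro x
  rw [LinearMap.comp_apply, LinearMap.comp_apply, hf, Representation.self_inv_apply]

lemma eqv_of_curry_mem {f : U ⊗[k] V →ₗ[k] W}
    (hf : TensorProduct.curry f ∈ (ρ.linHom (σ.linHom τ)).invariants) :
    Eqv (ρ.tprod σ) τ f := by
  intro g x
  have h := hf g
  rw [curry_conj] at h
  have h2 := TensorProduct.curry_injective h
  have h3 := LinearMap.congr_fun h2 ((ρ.tprod σ) g x)
  rw [← h3]
  simp only [LinearMap.comp_apply, Representation.inv_self_apply]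

lemma rnorm_curry (u : U ⊗[k] V →ₗ[k] W) :
    rnorm (ρ.linHom (σ.linHom τ)) (TensorProduct.curry u) =
      TensorProduct.curry (nrm (ρ.tprod σ) τ u) := by
  rw [rnorm_apply]
  simp only [curry_conj]
  apply LinearMap.ext
  intro x
  apply LinearMap.ext
  intro y
  simp [nrm, LinearMap.sum_apply]

lemma tate0mk_surj {ρ : Representation k G V} (z : tate0 ρ) : ∃ v hv, tate0mk v hv = z := by
  obtain ⟨⟨v, hv⟩, h⟩ := Submodule.Quotient.mk_surjective (rnormIm ρ) z
  exact ⟨v, hv, h⟩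

lemma tate0mk_eq {ρ : Representation k G V} {v w : V} (hv : v ∈ ρ.invariants)
    (hw : w ∈ ρ.invariants) : tate0mk v hv = tate0mk w hw ↔ ∃ u, v = w + rnorm ρ u := by
  refine (Submodule.Quotient.eq _).trans ?_
  constructor
  · rintro ⟨u, hu⟩
    have h : rnorm ρ u = v - w := congrArg Subtype.val hu
    exact ⟨u, by rw [h]; abel⟩
  · rintro ⟨u, hu⟩
    refine ⟨u, Subtype.ext ?_⟩
    show rnorm ρ u = v - w
    rw [hu]; abel

end Cls

section RCls

variable {k : Type} [CommRing k] {G : Type} [Group G] [Fintype G]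

/-- The Tate class of an equivariant map out of `Y ⊗ X`. -/
noncomputable def rcls (Y X A : Rep.{0} k G) (f : (Y ⊗ X).V →ₗ[k] A.V)
    (hf : Eqv (Y ⊗ X).ρ A.ρ f) : H0T ((Rep.ihom Y).obj ((Rep.ihom X).obj A)) :=
  tate0mk (ρ := Y.ρ.linHom (X.ρ.linHom A.ρ)) (TensorProduct.curry f) (curry_mem hf)

lemma rcls_surj (Y X A : Rep.{0} k G) (z : H0T ((Rep.ihom Y).obj ((Rep.ihom X).obj A))) :
    ∃ f hf, rcls Y X A f hf = z := by
  obtain ⟨v, hv, h⟩ := tate0mk_surj (ρ := Y.ρ.linHom (X.ρ.linHom A.ρ)) z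
  obtain ⟨f, rfl⟩ : ∃ f, TensorProduct.curry f = v :=
    ⟨TensorProduct.lift v, by ext; rfl⟩
  exact ⟨f, eqv_of_curry_mem hv, h⟩

lemma rcls_eq (Y X A : Rep.{0} k G) (f f') (hf hf') :
    rcls Y X A f hf = rcls Y X A f' hf' ↔ ∃ u, f = f' + nrm (Y ⊗ X).ρ A.ρ u := by
  refine (tate0mk_eq (ρ := Y.ρ.linHom (X.ρ.linHom A.ρ)) _ _).trans ?_
  constructor
  · rintro ⟨v, hv⟩
    obtain ⟨u, rfl⟩ : ∃ f, TensorProduct.curry f = v :=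
      ⟨TensorProduct.lift v, by ext; rfl⟩
    rw [rnorm_curry] at hv
    exact ⟨u, TensorProduct.curry_injective hv⟩
  · rintro ⟨u, rfl⟩
    refine ⟨TensorProduct.curry u, ?_⟩
    rw [rnorm_curry]
    rfl

lemma rcls_map (Y X A B : Rep.{0} k G) (f) (hf) (φ : A ⟶ B) :
    H0Tmap ((Rep.ihom Y).map ((Rep.ihom X).map φ)) (rcls Y X A f hf) =
      rcls Y X B (φ.hom.toLinearMap ∘ₗ f)
        (Eqv.comp (fun g v => Rep.hom_comm_apply φ g v) hf) := rfl

lemma rcls_add (Y X A : Rep.{0} k G) (f f') (hf hf') (h) :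
    rcls Y X A (f + f') h = rcls Y X A f hf + rcls Y X A f' hf' := rfl

end RCls

section TCls

variable {G : Type} [Group G] [Fintype G]

/-- The Tate class of an equivariant map out of `J n ⊗ X`. -/
noncomputable def tcls (i : ℤ) (X A : Rep.{0} ℤ G) (f : (J G i ⊗ X).V →ₗ[ℤ] A.V)
    (hf : Eqv (J G i ⊗ X).ρ A.ρ f) : tate i (hRep X A) := rcls (J G i) X A f hf

lemma tcls_surj (i : ℤ) (X A : Rep.{0} ℤ G) (z : tate i (hRep X A)) :
    ∃ f hf, tcls i X A f hf = z := rcls_surj (J G i) X A z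

lemma tcls_eq (i : ℤ) (X A : Rep.{0} ℤ G) (f f') (hf hf') :
    tcls i X A f hf = tcls i X A f' hf' ↔ ∃ u, f = f' + nrm (J G i ⊗ X).ρ A.ρ u :=
  rcls_eq (J G i) X A f f' hf hf'

lemma tcls_map (i : ℤ) (X A B : Rep.{0} ℤ G) (f) (hf) (φ : A ⟶ B) :
    tmap i ((Rep.ihom X).map φ) (tcls i X A f hf) =
      tcls i X B (φ.hom.toLinearMap ∘ₗ f)
        (Eqv.comp (fun g v => Rep.hom_comm_apply φ g v) hf) :=
  rcls_map (J G i) X A B f hf φ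

lemma tcls_add (i : ℤ) (X A : Rep.{0} ℤ G) (f f') (hf hf') (h) :
    tcls i X A (f + f') h = tcls i X A f hf + tcls i X A f' hf' :=
  rcls_add (J G i) X A f f' hf hf' h

def Eqv.toHom {X Y : Rep.{0} ℤ G} {f : X.V →ₗ[ℤ] Y.V} (hf : Eqv X.ρ Y.ρ f) : X ⟶ Y :=
  Rep.ofHom { toLinearMap := f, isIntertwining' := fun g => LinearMap.ext (hf g) }

lemma SR_of_enc {X X' : Rep.{0} ℤ G} (r : ℕ) (h : IsEncodingPair (r : ℤ) X X') :
    SR X (Jp G r ⊗ X') := by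
  obtain ⟨i, e, he⟩ := h
  refine SR.shift i r ?_
  have he' : ∀ {A B : Rep ℤ G} (φ : A ⟶ B) (z),
      (e B).symm (tmap (i + r) ((Rep.ihom X').map φ) z) =
        tmap i ((Rep.ihom X).map φ) ((e A).symm z) := by
    intro A B φ z
    rw [AddEquiv.symm_apply_eq, he, AddEquiv.apply_symm_apply]
  obtain ⟨f, hf, hfe⟩ := tcls_surj _ _ _ (e _ (tcls i X (J G i ⊗ X) LinearMap.id Eqv.id))
  obtain ⟨h, hh, hhe⟩ := tcls_surj _ _ _
    ((e _).symm (tcls (i + r) X' (J G (i + r) ⊗ X') LinearMap.id Eqv.id))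
  have k1 := he (Eqv.toHom hh) (tcls i X (J G i ⊗ X) LinearMap.id Eqv.id)
  rw [← hfe, tcls_map, tcls_map] at k1
  have k2 := he' (Eqv.toHom hf) (tcls (i + r) X' (J G (i + r) ⊗ X') LinearMap.id Eqv.id)
  rw [← hhe, tcls_map, tcls_map] at k2
  have k3 : e _ (tcls i X _ h hh) = tcls (i + r) X' (J G (i + r) ⊗ X') LinearMap.id Eqv.id := by
    rw [hhe, AddEquiv.apply_symm_apply]
  have k4 : (e _).symm (tcls (i + r) X' _ f hf) = tcls i X (J G i ⊗ X) LinearMap.id Eqv.id := by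
    rw [hfe, AddEquiv.symm_apply_apply]
  have k5 := (k1.symm.trans k3)
  have k6 := (k2.symm.trans k4)
  obtain ⟨w, hw⟩ := (tcls_eq _ _ _ _ _ _ _).1 k5
  obtain ⟨u, hu⟩ := (tcls_eq _ _ _ _ _ _ _).1 k6
  exact ⟨h, f, u, w, hh, hf, hu, hw⟩

/-- Precomposition on Tate classes. -/
noncomputable def tpre {i j : ℤ} {X X' : Rep.{0} ℤ G} {a : (J G j ⊗ X').V →ₗ[ℤ] (J G i ⊗ X).V}
    (ha : Eqv (J G j ⊗ X').ρ (J G i ⊗ X).ρ a) (A : Rep.{0} ℤ G) (z : tate i (hRep X A)) :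
    tate j (hRep X' A) :=
  tcls j X' A ((tcls_surj i X A z).choose ∘ₗ a)
    (Eqv.comp (tcls_surj i X A z).choose_spec.choose ha)

lemma tpre_tcls {i j : ℤ} {X X' : Rep.{0} ℤ G} {a : (J G j ⊗ X').V →ₗ[ℤ] (J G i ⊗ X).V}
    (ha : Eqv (J G j ⊗ X').ρ (J G i ⊗ X).ρ a) (A : Rep.{0} ℤ G) (f) (hf) :
    tpre ha A (tcls i X A f hf) = tcls j X' A (f ∘ₗ a) (Eqv.comp hf ha) := by
  obtain ⟨u, hu⟩ := (tcls_eq _ _ _ _ _ _ _).1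
    (tcls_surj i X A (tcls i X A f hf)).choose_spec.choose_spec
  refine (tcls_eq _ _ _ _ _ _ _).2 ⟨u ∘ₗ a, ?_⟩
  rw [hu, LinearMap.add_comp, nrm_comp ha]

lemma enc_of_SR_aux {X X' : Rep.{0} ℤ G} (i r : ℤ) (h : SR (J G i ⊗ X) (J G (i + r) ⊗ X')) :
    IsEncodingPair r X X' := by
  obtain ⟨b, a, u, w, hb, ha, h1, h2⟩ := h
  have l : ∀ A, Function.LeftInverse (tpre hb A) (tpre ha A) := by
    intro A z
    obtain ⟨f, hf, rfl⟩ := tcls_surj _ _ _ z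
    rw [tpre_tcls, tpre_tcls]
    refine (tcls_eq _ _ _ _ _ _ _).2 ⟨f ∘ₗ u, ?_⟩
    rw [LinearMap.comp_assoc, h1, LinearMap.comp_add, LinearMap.comp_id, comp_nrm hf]
  have l' : ∀ A, Function.RightInverse (tpre hb A) (tpre ha A) := by
    intro A z
    obtain ⟨f, hf, rfl⟩ := tcls_surj _ _ _ z
    rw [tpre_tcls, tpre_tcls]
    refine (tcls_eq _ _ _ _ _ _ _).2 ⟨f ∘ₗ w, ?_⟩
    rw [LinearMap.comp_assoc, h2, LinearMap.comp_add, LinearMap.comp_id, comp_nrm hf]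
  have l3 : ∀ A z z', tpre ha A (z + z') = tpre ha A z + tpre ha A z' := by
    intro A z z'
    obtain ⟨f, hf, rfl⟩ := tcls_surj _ _ _ z
    obtain ⟨f', hf', rfl⟩ := tcls_surj _ _ _ z'
    have hs : Eqv (J G i ⊗ X).ρ A.ρ (f + f') := fun g x => by
      rw [LinearMap.add_apply, LinearMap.add_apply, hf, hf', map_add]
    rw [← tcls_add i X A f f' hf hf' hs, tpre_tcls, tpre_tcls, tpre_tcls]
    exact tcls_add (i + r) X' A (f ∘ₗ a) (f' ∘ₗ a) (Eqv.comp hf ha) (Eqv.comp hf' ha)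
      (Eqv.comp hs ha)
  refine ⟨i, fun A => ⟨⟨tpre ha A, tpre hb A, l A, l' A⟩, l3 A⟩, ?_⟩
  · intro A B φ z
    obtain ⟨f, hf, rfl⟩ := tcls_surj _ _ _ z
    show tpre ha B _ = tmap _ _ (tpre ha A _)
    rw [tpre_tcls, tcls_map, tcls_map, tpre_tcls]
    rfl

lemma enc_of_SR {X X' : Rep.{0} ℤ G} (r : ℕ) (h : SR X (Jp G r ⊗ X')) :
    IsEncodingPair (r : ℤ) X X' := by
  refine enc_of_SR_aux 0 r ?_
  have e : (0 : ℤ) + (r : ℤ) = r := zero_add _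
  rw [e]
  exact (SR.lid X).trans h

end TCls

/-! ### Exact sequences -/

section Seqs

variable {G : Type} [Group G] [Fintype G]

/-- There is an exact sequence of length `r` with projective intermediate terms. -/
def HasSeq (r : ℕ) (X X' : Rep.{0} ℤ G) : Prop :=
  ∃ (C : ℕ → Rep.{0} ℤ G) (d : ∀ i : ℕ, C (i + 1) ⟶ C i),
    C 0 = X' ∧ C (r + 1) = X ∧
    (∀ i, 1 ≤ i → i ≤ r → Module.Projective (MonoidAlgebra ℤ G) (C i).ρ.asModule) ∧
    Function.Injective (d r).hom ∧ Function.Surjective (d 0).hom ∧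
    ∀ i, i + 1 ≤ r → Function.Exact (⇑(d (i + 1)).hom) (⇑(d i).hom)

/-- A short exact sequence with projective middle term. -/
def PSES (X P Y : Rep.{0} ℤ G) (ι : X ⟶ P) (π : P ⟶ Y) : Prop :=
  Module.Projective (MonoidAlgebra ℤ G) P.ρ.asModule ∧ Function.Injective ι.hom ∧
    Function.Surjective π.hom ∧ Function.Exact ι.hom π.hom

lemma HasSeq.refl (X : Rep.{0} ℤ G) : HasSeq 0 X X :=
  ⟨fun _ => X, fun _ => 𝟙 X, rfl, rfl, fun i h1 h2 => absurd h1 (by omega),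
    fun _ _ h => h, fun x => ⟨x, rfl⟩, fun i h => absurd h (by omega)⟩

/-- Spliced objects. -/
def spC (P X' : Rep.{0} ℤ G) (C : ℕ → Rep.{0} ℤ G) : ℕ → Rep.{0} ℤ G
  | 0 => X'
  | 1 => P
  | i + 2 => C (i + 1)

/-- Spliced differentials. -/
noncomputable def spD {P X' : Rep.{0} ℤ G} {C : ℕ → Rep.{0} ℤ G} (d : ∀ i : ℕ, C (i + 1) ⟶ C i)
    (ι : C 0 ⟶ P) (π : P ⟶ X') : ∀ i : ℕ, spC P X' C (i + 1) ⟶ spC P X' C i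
  | 0 => π
  | 1 => d 0 ≫ ι
  | i + 2 => d (i + 1)

lemma HasSeq.splice {r : ℕ} {X Y P X' : Rep.{0} ℤ G} {ι : Y ⟶ P} {π : P ⟶ X'}
    (h : HasSeq r X Y) (hP : PSES Y P X' ι π) : HasSeq (r + 1) X X' := by
  obtain ⟨C, d, rfl, rfl, hp, hi, hs, he⟩ := h
  obtain ⟨pp, pi, ps, pe⟩ := hP
  have e1 : ∀ x, (d 0 ≫ ι).hom x = ι.hom ((d 0).hom x) := fun x => rfl
  refine ⟨spC P X' C, spD d ι π, rfl, rfl, ?_, ?_, ps, ?_⟩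
  · rintro (_ | _ | i) h1 h2
    · omega
    · exact pp
    · exact hp (i + 1) (by omega) (by omega)
  · cases r with
    | zero =>
      intro x y hxy
      exact hi (pi hxy)
    | succ r => exact hi
  · rintro (_ | _ | i) h
    · intro x
      refine (pe x).trans ⟨?_, ?_⟩
      · rintro ⟨y, rfl⟩
        obtain ⟨z, rfl⟩ := hs y
        exact ⟨z, rfl⟩
      · rintro ⟨z, rfl⟩
        exact ⟨(d 0).hom z, rfl⟩
    · intro x
      refine Iff.trans ?_ (he 0 (by omega) x)
      constructor
      · intro hx
        exact pi (hx.trans (map_zero ι.hom).symm)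
      · intro hx
        exact (congrArg ι.hom hx).trans (map_zero ι.hom)
    · exact he (i + 1) (by omega)

lemma Syz.toPSES {X P Y : Rep.{0} ℤ G} [Module.Projective ℤ P.V] (S : Syz X.ρ P.ρ Y.ρ) :
    PSES X P Y S.hi.toHom S.hp.toHom := by
  refine ⟨projective_of_norm S.n S.hn, S.inj, fun x => ⟨S.s x, S.ps' x⟩, ?_⟩
  intro x
  constructor
  · intro hx
    refine ⟨S.t x, ?_⟩
    have h := S.sum' x
    have hx' : S.p x = 0 := hx
    rw [hx', map_zero, add_zero] at h
    exact h
  · rintro ⟨y, rfl⟩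
    exact S.pi' y

lemma one_step {X Y : Rep.{0} ℤ G} (hX : Module.Projective ℤ X.V) (hY : Module.Projective ℤ Y.V)
    (h : SR X (IGrep G ⊗ Y)) : ∃ (P : Rep.{0} ℤ G) (ι : X ⟶ P) (π : P ⟶ Y), PSES X P Y ι π := by
  obtain ⟨p, ⟨S⟩⟩ := Syz.pushout (k := ℤ) (V := IGcar G ⊗[ℤ] Y.V) (V₂ := (G →₀ ℤ) ⊗[ℤ] Y.V)
    (augSyzT G Y.ρ) h.symm
  let P : Rep.{0} ℤ G := Rep.of p
  have : Module.Projective ℤ P.V := by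
    show Module.Projective ℤ (X.V × Y.V)
    infer_instance
  exact ⟨P, _, _, Syz.toPSES (X := X) (P := P) (Y := Y) S⟩

lemma I_proj {X : Rep.{0} ℤ G} (hX : Module.Projective ℤ X.V) :
    Module.Projective ℤ (IGrep G ⊗ X).V := by
  have : Module.Projective ℤ (IGcar G ⊗[ℤ] X.V) := inferInstance
  exact this

lemma seq_of_SR : ∀ (r : ℕ) {X X' : Rep.{0} ℤ G}, Module.Projective ℤ X.V →
    Module.Projective ℤ X'.V → SR X (Jp G (r + 1) ⊗ X') → HasSeq (r + 1) X X'
  | 0, X, X', hX, hX', h => by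
    obtain ⟨P, ι, π, hP⟩ := one_step hX hX' (h.trans ((SR.lid (IGrep G)).rT X'))
    exact (HasSeq.refl X).splice hP
  | r + 1, X, X', hX, hX', h => by
    obtain ⟨P, ι, π, hP⟩ := one_step (I_proj hX') hX' (SR.refl _)
    exact (seq_of_SR r hX (I_proj hX') (h.trans (SR.assoc _ _ _))).splice hP

/-- The kernel of a morphism as a representation. -/
def kerRep {P Y : Rep.{0} ℤ G} (f : P ⟶ Y) : Rep.{0} ℤ G :=
  Rep.of (X := LinearMap.ker f.hom.toLinearMap)
    { toFun := fun g => (P.ρ g).restrict (p := LinearMap.ker f.hom.toLinearMap)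
        (q := LinearMap.ker f.hom.toLinearMap) (by
          intro x hx
          have hx' : f.hom x = 0 := hx
          show f.hom (P.ρ g x) = 0
          rw [Rep.hom_comm_apply, hx', map_zero])
      map_one' := by
        apply LinearMap.ext
        intro x
        apply Subtype.ext
        show P.ρ 1 x = x
        simp
      map_mul' := fun g h => by
        apply LinearMap.ext
        intro x
        apply Subtype.ext
        show P.ρ (g * h) x = P.ρ g (P.ρ h x)
        simp }

lemma ker_syz {P Y : Rep.{0} ℤ G} (f : P ⟶ Y) (hf : Function.Surjective f.hom)
    (hY : Module.Projective ℤ Y.V)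
    (hP : Module.Projective (MonoidAlgebra ℤ G) P.ρ.asModule) :
    Module.Projective ℤ (kerRep f).V ∧ Nonempty (Syz (kerRep f).ρ P.ρ Y.ρ) := by
  obtain ⟨hP, n, hn⟩ := norm_of_projective hP
  obtain ⟨s, hs⟩ := LinearMap.exists_rightInverse_of_surjective f.hom.toLinearMap
    (LinearMap.range_eq_top.2 hf)
  have hs' : ∀ y, f.hom (s y) = y := LinearMap.congr_fun hs
  let i : (kerRep f).V →ₗ[ℤ] P.V := (LinearMap.ker f.hom.toLinearMap).subtype
  let t : P.V →ₗ[ℤ] (kerRep f).V :=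
    (LinearMap.id - s ∘ₗ f.hom.toLinearMap).codRestrict (LinearMap.ker f.hom.toLinearMap) (by
      intro x
      show f.hom (x - s (f.hom x)) = 0
      rw [map_sub, hs', sub_self])
  have hit : ∀ x, i (t x) = x - s (f.hom x) := fun x => rfl
  have ii : Function.Injective i := Subtype.val_injective
  have fi : ∀ x, f.hom (i x) = 0 := fun x => x.2
  have ti : t ∘ₗ i = LinearMap.id := by
    apply LinearMap.ext
    intro x
    apply ii
    rw [LinearMap.comp_apply, hit, fi, map_zero, sub_zero]
    rfl
  refine ⟨Module.Projective.of_split i t ti, ⟨⟨i, f.hom.toLinearMap, s, t, n, fun g x => rfl,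
    fun g x => Rep.hom_comm_apply f g x, ti, hs, LinearMap.ext fi, ?_, hn⟩⟩⟩
  apply LinearMap.ext
  intro x
  show i (t x) + s (f.hom x) = x
  rw [hit, sub_add_cancel]

/-- Truncated objects. -/
def trC (Y : Rep.{0} ℤ G) (C : ℕ → Rep.{0} ℤ G) : ℕ → Rep.{0} ℤ G
  | 0 => Y
  | i + 1 => C (i + 2)

/-- Truncated differentials. -/
noncomputable def trD {Y : Rep.{0} ℤ G} {C : ℕ → Rep.{0} ℤ G} (d : ∀ i : ℕ, C (i + 1) ⟶ C i)
    (e : C 2 ⟶ Y) : ∀ i : ℕ, trC Y C (i + 1) ⟶ trC Y C i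
  | 0 => e
  | i + 1 => d (i + 2)

lemma HasSeq.unsplice {r : ℕ} {X X' : Rep.{0} ℤ G} (hX' : Module.Projective ℤ X'.V)
    (h : HasSeq (r + 1) X X') :
    ∃ Y : Rep.{0} ℤ G, Module.Projective ℤ Y.V ∧ SR Y (IGrep G ⊗ X') ∧ HasSeq r X Y := by
  obtain ⟨C, d, rfl, rfl, hp, hi, hs, he⟩ := h
  obtain ⟨hY, ⟨S⟩⟩ := ker_syz (d 0) hs hX' (hp 1 (by omega) (by omega))
  have hSR : SR (kerRep (d 0)) (IGrep G ⊗ C 0) :=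
    Syz.schanuel (k := ℤ) (V₄ := IGcar G ⊗[ℤ] (C 0).V) (V₅ := (G →₀ ℤ) ⊗[ℤ] (C 0).V) S
      (augSyzT G (C 0).ρ)
  have e0 := he 0 (by omega)
  let e : C 2 ⟶ kerRep (d 0) := Rep.ofHom
    { toLinearMap := (d 1).hom.toLinearMap.codRestrict (LinearMap.ker (d 0).hom.toLinearMap)
        (fun x => (e0 _).2 ⟨x, rfl⟩)
      isIntertwining' := fun g => by
        apply LinearMap.ext
        intro x
        apply Subtype.ext
        exact Rep.hom_comm_apply (d 1) g x }
  refine ⟨kerRep (d 0), hY, hSR, trC _ C, trD d e, rfl, rfl, ?_, ?_, ?_, ?_⟩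
  · rintro (_ | i) h1 h2
    · omega
    · exact hp (i + 2) (by omega) (by omega)
  · cases r with
    | zero =>
      intro x y hxy
      exact hi (congrArg Subtype.val hxy)
    | succ r => exact hi
  · rintro ⟨y, hy⟩
    obtain ⟨x, hx⟩ := (e0 y).1 hy
    exact ⟨x, Subtype.ext hx⟩
  · rintro (_ | i) h
    · intro x
      refine Iff.trans ?_ (he 1 (by omega) x)
      constructor
      · intro hx
        exact congrArg Subtype.val hx
      · intro hx
        exact Subtype.ext hx
    · exact he (i + 2) (by omega)

lemma SR_of_seq : ∀ (r : ℕ) {X X' : Rep.{0} ℤ G}, Module.Projective ℤ X'.V →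
    HasSeq r X X' → SR X (Jp G r ⊗ X')
  | 0, X, X', hX', h => by
    obtain ⟨C, d, rfl, rfl, hp, hi, hs, he⟩ := h
    refine SR.trans ?_ (SR.lid _).symm
    exact SIso.of_equiv (LinearEquiv.ofBijective (d 0).hom.toLinearMap ⟨hi, hs⟩)
      (fun g x => Rep.hom_comm_apply (d 0) g x)
  | r + 1, X, X', hX', h => by
    obtain ⟨Y, hY, hYX, hs⟩ := h.unsplice hX'
    exact ((SR_of_seq r hY hs).trans (hYX.lT _)).trans (SR.assoc _ _ _).symm

end Seqs

theorem statement6 (G : Type) [Group G] [Fintype G] (X X' : Rep ℤ G)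
    (hX : Module.Free ℤ X.V) (hX' : Module.Free ℤ X'.V) (r : ℕ) (hr : 0 < r) :
    IsEncodingPair (r : ℤ) X X' ↔
      ∃ (C : ℕ → Rep ℤ G) (d : ∀ i : ℕ, C (i + 1) ⟶ C i),
        C 0 = X' ∧ C (r + 1) = X ∧
        (∀ i, 1 ≤ i → i ≤ r → Module.Projective (MonoidAlgebra ℤ G) (C i).ρ.asModule) ∧
        Function.Injective (d r).hom ∧ Function.Surjective (d 0).hom ∧
        ∀ i, i + 1 ≤ r → Function.Exact (⇑(d (i + 1)).hom) (⇑(d i).hom) := by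
  have pX : Module.Projective ℤ X.V := Module.Projective.of_free
  have pX' : Module.Projective ℤ X'.V := Module.Projective.of_free
  constructor
  · intro h
    obtain ⟨s, rfl⟩ : ∃ s, r = s + 1 := ⟨r - 1, by omega⟩
    exact seq_of_SR s pX pX' (SR_of_enc _ h)
  · intro h
    exact enc_of_SR r (SR_of_seq r pX' h)
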